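/- arXiv:2003.08537 — 2 statements merged into one kernel-verified Lean document; each statement's English description precedes it below -/
import Mathlib

section
/- Let W = w₁⊗⋯⊗wₙ ∈ ℝ^{d₁×⋯×dₙ} be a CP rank-one tensor with strictly positive entries, let Ω ⊆ [d₁]×⋯×[dₙ], let T ∈ ℝ^{d₁×⋯×dₙ} satisfy rank(T_{(k)}) ≤ r_k for a fixed k ∈ {1,…,n}, let Z ∈ ℝ^{d₁×⋯×dₙ} be an arbitrary tensor, and set Y_Ω = 1_Ω∘(T+Z). Then ‖(W^{(−1/2)}∘Y_Ω − W^{(1/2)}∘T)_{(k)}‖₂ ≤ √(r_k)·‖T‖_∞·‖(W^{(−1/2)}∘1_Ω − W^{(1/2)})_{(k)}‖₂ + ‖(W^{(−1/2)}∘Z_Ω)_{(k)}‖₂. -/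
open MeasureTheory ProbabilityTheory Matrix
open scoped BigOperators ENNReal

namespace WTC

variable {n : ℕ}

/-- The index set `[d₁] × ⋯ × [dₙ]`. -/
abbrev Index (d : Fin n → ℕ) := ∀ j, Fin (d j)

/-- A real tensor of size `d₁ × ⋯ × dₙ`. -/
abbrev Tensor (d : Fin n → ℕ) := Index d → ℝ

variable {d : Fin n → ℕ}

/-- Frobenius norm of a tensor. -/
noncomputable def frobNorm (X : Tensor d) : ℝ :=
  Real.sqrt (∑ i : Index d, X i ^ 2)

/-- Sup (max-abs-entry) norm of a tensor. -/
noncomputable def infNorm (X : Tensor d) : ℝ := ⨆ i : Index d, |X i|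

/-- Hadamard (entrywise) product. -/
def hadamard (X Y : Tensor d) : Tensor d := fun i => X i * Y i

/-- Entrywise real power `X^{(α)}`. -/
noncomputable def epow (X : Tensor d) (α : ℝ) : Tensor d := fun i => X i ^ α

/-- The indicator tensor `1_Ω` of a sampling pattern. -/
def indic (Ω : Finset (Index d)) : Tensor d := fun i => if i ∈ Ω then 1 else 0

/-- The CP rank-one tensor `w₁ ⊗ ⋯ ⊗ wₙ`. -/
def outer (w : ∀ j, Fin (d j) → ℝ) : Tensor d := fun i => ∏ j, w j (i j)

/-- Index type for the columns of the mode-`k` matricization. -/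
abbrev RestIdx (d : Fin n → ℕ) (k : Fin n) := ∀ j : {j : Fin n // j ≠ k}, Fin (d j.1)

/-- Assemble a full index from a mode-`k` index and the remaining indices. -/
def embed (k : Fin n) (ik : Fin (d k)) (rest : RestIdx d k) : Index d :=
  fun j => if h : j = k then cast (congrArg (fun t => Fin (d t)) h).symm ik else rest ⟨j, h⟩

/-- Mode-`k` matricization of a tensor. -/
def matricize (k : Fin n) (X : Tensor d) : Matrix (Fin (d k)) (RestIdx d k) ℝ :=
  fun ik rest => X (embed k ik rest)

/-- Spectral norm (largest singular value) of a matrix. -/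
noncomputable def specNorm {m l : Type*} [Fintype m] [Fintype l] [DecidableEq l]
    (M : Matrix m l ℝ) : ℝ :=
  ‖LinearMap.toContinuousLinearMap (Matrix.toEuclideanLin M)‖

/-- `X` has Tucker rank at most `r`. -/
def TuckerRankLE (X : Tensor d) (r : Fin n → ℕ) : Prop :=
  ∀ k, (matricize k X).rank ≤ r k

/-- `X` has Tucker rank exactly `r`. -/
def TuckerRankEq (X : Tensor d) (r : Fin n → ℕ) : Prop :=
  ∀ k, (matricize k X).rank = r k

/-- `X` has CP rank at most `r`. -/
def CPRankLE (X : Tensor d) (r : ℕ) : Prop :=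
  ∃ v : Fin r → ∀ j, Fin (d j) → ℝ, X = fun i => ∑ s, ∏ j, v s j (i j)

/-- Mode-`k` product of a tensor with a square matrix: `(X ×ₖ A)_(k) = A · X_(k)`. -/
noncomputable def modeProd (k : Fin n) (X : Tensor d)
    (A : Matrix (Fin (d k)) (Fin (d k)) ℝ) : Tensor d :=
  fun i => ∑ s : Fin (d k), A (i k) s * X (Function.update i k s)

/-- Sequential mode products `X ×₁ A₁ ×₂ ⋯ ×ₙ Aₙ`. -/
noncomputable def modeProds (X : Tensor d)
    (A : ∀ k, Matrix (Fin (d k)) (Fin (d k)) ℝ) : Tensor d :=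
  (List.finRange n).foldl (fun Y k => modeProd k Y (A k)) X

/-- `That` is a weighted HOSVD estimate built from observations `Y` (typically `Y = Y_Ω`),
weight `W` and multilinear rank `r`. -/
def IsHOSVDEstimate (W : Tensor d) (r : Fin n → ℕ) (Y : Tensor d) (That : Tensor d) : Prop :=
  ∃ U : ∀ k, Matrix (Fin (d k)) (Fin (r k)) ℝ,
    (∀ k, (U k)ᵀ * U k = 1) ∧
    (∀ k, ∀ B : Matrix (Fin (d k)) (RestIdx d k) ℝ, B.rank ≤ r k →
      specNorm (matricize k (hadamard (epow W (-(1/2))) Y)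
          - U k * (U k)ᵀ * matricize k (hadamard (epow W (-(1/2))) Y))
        ≤ specNorm (matricize k (hadamard (epow W (-(1/2))) Y) - B)) ∧
    That = hadamard (epow W (-(1/2)))
      (modeProds (hadamard (epow W (-(1/2))) Y) (fun k => U k * (U k)ᵀ))

/-- Distribution of a tensor with i.i.d. `N(0, σ²)` entries. -/
noncomputable def gaussianTensor (d : Fin n → ℕ) (σ : ℝ) : Measure (Tensor d) :=
  Measure.pi fun _ : Index d => gaussianReal 0 (σ ^ 2).toNNReal

/-- Bernoulli measure on `Bool` with success probability `p`. -/
noncomputable def bern (p : ℝ) : Measure Bool :=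
  ENNReal.ofReal p • Measure.dirac true + ENNReal.ofReal (1 - p) • Measure.dirac false

/-- Distribution of a random sampling pattern `Ω ∼ W`: each index is included
independently with probability `W i`.  A pattern is encoded as a boolean function. -/
noncomputable def sampleMeasure (W : Tensor d) : Measure (Index d → Bool) :=
  Measure.pi fun i => bern (W i)

/-- Indicator tensor of a boolean sampling pattern. -/
def bindic (ω : Index d → Bool) : Tensor d := fun i => if ω i then 1 else 0

/-- The size `|Ω|` of a boolean sampling pattern. -/
noncomputable def patCard (ω : Index d → Bool) : ℕ :=
  (Finset.univ.filter fun i : Index d => ω i = true).card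


/-- `ℓ¹` norm of a vector. -/
noncomputable def l1 {ι : Type*} [Fintype ι] (v : ι → ℝ) : ℝ := ∑ i, |v i|

/-- `ℓ²` norm of a vector. -/
noncomputable def l2 {ι : Type*} [Fintype ι] (v : ι → ℝ) : ℝ := Real.sqrt (∑ i, v i ^ 2)

/-- `ℓ^∞` norm of a vector. -/
noncomputable def linf {ι : Type*} [Fintype ι] (v : ι → ℝ) : ℝ := ⨆ i, |v i|

/-- Frobenius norm of a matrix. -/
noncomputable def matFrob {m l : Type*} [Fintype m] [Fintype l] (M : Matrix m l ℝ) : ℝ :=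
  Real.sqrt (∑ i, ∑ j, M i j ^ 2)

/-- Kronecker product of a family of square matrices (indexed functionally). -/
def kronFamily {r : Fin n → ℕ} (M : ∀ k, Matrix (Fin (r k)) (Fin (r k)) ℝ) :
    Matrix (∀ k, Fin (r k)) (∀ k, Fin (r k)) ℝ :=
  fun i j => ∏ k, M k (i k) (j k)

/-- The quantity `d_k + ∏_{j ≠ k} d_j`. -/
noncomputable def Dk (d : Fin n → ℕ) (k : Fin n) : ℝ :=
  (d k : ℝ) + ∏ j ∈ Finset.univ.erase k, (d j : ℝ)

/-- The vector `w_k = (h_k ∘ b_k)^{(2)}`. -/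
def wvec {d : Fin n → ℕ} (h b : ∀ j, Fin (d j) → ℝ) (k : Fin n) : Fin (d k) → ℝ :=
  fun ik => (h k ik * b k ik) ^ 2

/-- Law of a uniformly random `±1`-valued tensor (encoded by booleans). -/
noncomputable def signMeasure (ι : Type*) [Fintype ι] [DecidableEq ι] : Measure (ι → Bool) :=
  (PMF.uniformOfFintype (ι → Bool)).toMeasure

/-- Law of a random vector with i.i.d. entries equal to `1` with probability `1/4`,
`-1` with probability `1/4` and `0` with probability `1/2`. -/
noncomputable def xiMeasure (ι : Type*) [Fintype ι] [DecidableEq ι] : Measure (ι → ℝ) :=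
  ((PMF.uniformOfFintype (ι → Fin 4)).map
    (fun b i => (![0, 0, 1, -1] : Fin 4 → ℝ) (b i))).toMeasure

/-- The weighted Gram matrix `∑ᵢ pᵢ uᵢᵀ uᵢ` of the rows `uᵢ` of `U`. -/
def weightedGram {m ρ : Type*} [Fintype m] [DecidableEq m] (U : Matrix m ρ ℝ) (p : m → ℝ) :
    Matrix ρ ρ ℝ :=
  Uᵀ * diagonal p * U

section Design

variable {m l ρ : Type*} [Fintype m] [DecidableEq m]

lemma weightedGram_apply (U : Matrix m ρ ℝ) (p : m → ℝ) (a b : ρ) :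
    weightedGram U p a b = ∑ i, p i * U i a * U i b := by
  rw [weightedGram, mul_apply]
  simp only [mul_diagonal, transpose_apply]
  exact Finset.sum_congr rfl fun _ _ => by ring

lemma weightedGram_move (U : Matrix m ρ ℝ) (p : m → ℝ) (t : ℝ) (i : m) :
    weightedGram U ((1 - t) • p + t • Pi.single i 1) =
      (1 - t) • weightedGram U p + vecMulVec (t • U i) (U i) := by
  ext a b
  simp only [weightedGram_apply, Pi.add_apply, Pi.smul_apply, smul_eq_mul, Matrix.add_apply,
    Matrix.smul_apply, vecMulVec_apply, add_mul, Finset.sum_add_distrib, Finset.mul_sum]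
  congr 1
  · exact Finset.sum_congr rfl fun _ _ => by ring
  · simp [Pi.single_apply]

variable [Fintype ρ]

lemma weightedGram_posSemidef (U : Matrix m ρ ℝ) {p : m → ℝ} (hp : ∀ i, 0 ≤ p i) :
    (weightedGram U p).PosSemidef := by
  have h := (PosSemidef.diagonal (R := ℝ) (d := p) hp).conjTranspose_mul_mul_same U
  rwa [conjTranspose_eq_transpose_of_trivial] at h

lemma weightedGram_posDef (U : Matrix m ρ ℝ) (hU : Function.Injective U.mulVec)
    {p : m → ℝ} (hp : ∀ i, 0 < p i) : (weightedGram U p).PosDef := by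
  have h := (PosDef.diagonal (R := ℝ) (d := p) hp).conjTranspose_mul_mul_same (B := U) hU
  rwa [conjTranspose_eq_transpose_of_trivial] at h

lemma dotProduct_weightedGram (U : Matrix m ρ ℝ) (p : m → ℝ) (v : ρ → ℝ) :
    v ⬝ᵥ weightedGram U p *ᵥ v = ∑ i, p i * (U *ᵥ v) i ^ 2 := by
  rw [weightedGram, ← mulVec_mulVec, ← mulVec_mulVec, dotProduct_mulVec, vecMul_transpose]
  simp only [dotProduct, mulVec_diagonal]
  exact Finset.sum_congr rfl fun _ _ => by ring

lemma det_smul_add_vecMulVec [DecidableEq ρ] (M : Matrix ρ ρ ℝ) (hM : M.det ≠ 0) (u : ρ → ℝ) {t : ℝ}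
    (ht : t < 1) :
    ((1 - t) • M + vecMulVec (t • u) u).det =
      (1 - t) ^ Fintype.card ρ * M.det * (1 + t / (1 - t) * (u ⬝ᵥ M⁻¹ *ᵥ u)) := by
  have h1 : 1 - t ≠ 0 := by linarith
  have hu : IsUnit M.det := isUnit_iff_ne_zero.mpr hM
  have key : (1 - t) • M + vecMulVec (t • u) u =
      ((1 - t) • M) * (1 + replicateCol Unit ((t / (1 - t)) • (M⁻¹ *ᵥ u)) * replicateRow Unit u) := by
    rw [← vecMulVec_eq, mul_add, mul_one, mul_vecMulVec, smul_mulVec, mulVec_smul, mulVec_mulVec,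
      mul_nonsing_inv _ hu, one_mulVec, smul_smul, mul_div_cancel₀ _ h1]
  rw [key, det_mul, det_smul, det_one_add_replicateCol_mul_replicateRow, dotProduct_smul,
    smul_eq_mul]

lemma le_of_one_sub_pow_mul_le (r : ℕ) (g : ℝ) (hr : r ≠ 0)
    (h : ∀ t : ℝ, 0 < t → t < 1 → (1 - t) ^ r * (1 + t / (1 - t) * g) ≤ 1) : g ≤ r := by
  obtain ⟨s, rfl⟩ := Nat.exists_eq_succ_of_ne_zero hr
  by_contra! hg
  push_cast at hg
  have hs : (0 : ℝ) ≤ s := s.cast_nonneg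
  have hbound : ∀ t : ℝ, 0 < t → t < 1 → g - (s + 1) ≤ s * (g - 1) * t := by
    intro t ht ht1
    have h1 : 1 - t ≠ 0 := by linarith
    have h2 := h t ht ht1
    have e : (1 - t) ^ (s + 1) * (1 + t / (1 - t) * g) = (1 - t) ^ s * (1 + t * (g - 1)) := by
      rw [pow_succ]; field_simp; ring
    rw [Nat.succ_eq_add_one, e] at h2
    have h3 := one_add_mul_le_pow (a := -t) (by linarith) s
    have h4 : 0 ≤ 1 + t * (g - 1) := by nlinarith
    have h5 : (1 + s * -t) * (1 + t * (g - 1)) ≤ 1 := by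
      refine le_trans (mul_le_mul_of_nonneg_right h3 h4) ?_
      simpa [sub_eq_add_neg] using h2
    have h6 : t * (g - (s + 1)) ≤ t * (s * (g - 1) * t) := by nlinarith
    exact le_of_mul_le_mul_left h6 ht
  set c : ℝ := s * (g - 1) with hc
  have hc0 : 0 ≤ c := mul_nonneg hs (by linarith)
  set δ : ℝ := g - (s + 1) with hδ
  have hδ0 : 0 < δ := by linarith
  have h7 := hbound (δ / (δ + c + 1)) (by positivity)
    ((div_lt_one (by positivity)).mpr (by linarith))
  rw [mul_div_assoc', le_div_iff₀ (by positivity)] at h7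
  nlinarith

/-- **Kiefer–Wolfowitz**: a D-optimal design exists and has leverage scores at most the
dimension. -/
lemma exists_optimal_design [DecidableEq ρ] (U : Matrix m ρ ℝ) (hU : Function.Injective U.mulVec) :
    ∃ p : m → ℝ, (∀ i, 0 ≤ p i) ∧ ∑ i, p i ≤ 1 ∧ 0 < (weightedGram U p).det ∧
      ∀ i, U i ⬝ᵥ (weightedGram U p)⁻¹ *ᵥ U i ≤ Fintype.card ρ := by
  let K : Set (m → ℝ) := {p | (∀ i, 0 ≤ p i) ∧ ∑ i, p i ≤ 1}
  have hKle : K ⊆ Set.Icc 0 1 := fun p hp =>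
    ⟨hp.1, fun i => (Finset.single_le_sum (fun j _ => hp.1 j) (Finset.mem_univ i)).trans hp.2⟩
  have hKclosed : IsClosed K := by
    have h0 : IsClosed {p : m → ℝ | ∀ i, 0 ≤ p i} :=
      isClosed_le (f := fun _ : m → ℝ => (0 : m → ℝ)) continuous_const continuous_id
    have h1 : IsClosed {p : m → ℝ | ∑ i, p i ≤ 1} := isClosed_le (by fun_prop) continuous_const
    exact h0.inter h1
  have hK : IsCompact K := isCompact_Icc.of_isClosed_subset hKclosed hKle
  have hcont : Continuous fun p : m → ℝ => (weightedGram U p).det := by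
    unfold weightedGram
    fun_prop
  let p₀ : m → ℝ := fun _ => 1 / ((Fintype.card m : ℝ) + 1)
  have hp₀ : ∀ i, 0 < p₀ i := fun i => by positivity
  have hp₀K : p₀ ∈ K := by
    refine ⟨fun i => (hp₀ i).le, ?_⟩
    simp only [p₀, Finset.sum_const, Finset.card_univ, nsmul_eq_mul]
    rw [mul_one_div, div_le_one (by positivity)]
    linarith
  obtain ⟨p, hpK, hmax⟩ := hK.exists_isMaxOn ⟨p₀, hp₀K⟩ hcont.continuousOn
  have hdet : 0 < (weightedGram U p).det :=
    (weightedGram_posDef U hU hp₀).det_pos.trans_le (hmax hp₀K)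
  refine ⟨p, hpK.1, hpK.2, hdet, fun i => ?_⟩
  rcases isEmpty_or_nonempty ρ with hρ | hρ
  · simp [dotProduct]
  refine le_of_one_sub_pow_mul_le _ _ Fintype.card_ne_zero fun t ht ht1 => ?_
  have hmem : (1 - t) • p + t • Pi.single i 1 ∈ K := by
    refine ⟨fun j => ?_, ?_⟩
    · have h1 := hpK.1 j
      have h2 : (0 : ℝ) ≤ (Pi.single i 1 : m → ℝ) j := by
        rw [Pi.single_apply]; split_ifs <;> norm_num
      have h3 : 0 ≤ 1 - t := by linarith
      simp only [Pi.add_apply, Pi.smul_apply, smul_eq_mul]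
      positivity
    · simp only [Pi.add_apply, Pi.smul_apply, smul_eq_mul, Finset.sum_add_distrib,
        ← Finset.mul_sum, Finset.sum_pi_single', Finset.mem_univ, if_true]
      nlinarith [hpK.2]
  have hle : (weightedGram U ((1 - t) • p + t • Pi.single i 1)).det ≤ (weightedGram U p).det :=
    hmax hmem
  rw [weightedGram_move, det_smul_add_vecMulVec _ hdet.ne' _ ht1] at hle
  refine le_of_mul_le_mul_right ?_ hdet
  linarith

open scoped MatrixOrder Matrix.Norms.L2Operator in
lemma exists_eq_transpose_mul_self [DecidableEq ρ] {M : Matrix ρ ρ ℝ} (hM : M.PosSemidef) :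
    ∃ B : Matrix ρ ρ ℝ, M = Bᵀ * B := by
  obtain ⟨B, hB⟩ := CStarAlgebra.nonneg_iff_eq_star_mul_self.mp hM.nonneg
  exact ⟨B, by rw [hB, star_eq_conjTranspose, conjTranspose_eq_transpose_of_trivial]⟩

lemma exists_injective_mul_eq {m l : Type*} [Fintype l] [DecidableEq l] (T : Matrix m l ℝ) :
    ∃ (U : Matrix m (Fin T.rank) ℝ) (V : Matrix (Fin T.rank) l ℝ),
      Function.Injective U.mulVec ∧ T = U * V := by
  let S := LinearMap.range T.mulVecLin
  let b : Module.Basis (Fin T.rank) ℝ S := Module.finBasis ℝ S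
  have hU : ∀ c : Fin T.rank → ℝ,
      (Matrix.of fun i s => (b s : m → ℝ) i) *ᵥ c = ((b.equivFun.symm c : S) : m → ℝ) := by
    intro c
    ext i
    simp [mulVec, dotProduct, Module.Basis.equivFun_symm_apply, mul_comm]
  let col : l → S := fun j => ⟨T.col j, ⟨Pi.single j 1, by simp⟩⟩
  refine ⟨Matrix.of fun i s => (b s : m → ℝ) i, Matrix.of fun s j => b.equivFun (col j) s, ?_, ?_⟩
  · intro c c' h
    simp only [hU] at h
    exact b.equivFun.symm.injective (Subtype.ext h)
  · ext i j
    have h := congrFun (hU (b.equivFun (col j))) i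
    rw [LinearEquiv.symm_apply_apply] at h
    exact h.symm

/-- A matrix of rank `r` factors through `ℝ^r` with
`‖U‖_{2→∞} ‖V‖_{1→2} ≤ √r · max |Tᵢⱼ|` (John's theorem). -/
lemma exists_balanced_factorization [Fintype l] [DecidableEq l] (T : Matrix m l ℝ) {τ : ℝ} (hτ : ∀ i j, |T i j| ≤ τ) :
    ∃ (U : Matrix m (Fin T.rank) ℝ) (V : Matrix (Fin T.rank) l ℝ), T = U * V ∧
      (∀ i, ∑ s, U i s ^ 2 ≤ T.rank) ∧ ∀ j, ∑ s, V s j ^ 2 ≤ τ ^ 2 := by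
  obtain ⟨U, V, hU, hT⟩ := exists_injective_mul_eq T
  obtain ⟨p, hp0, hp1, hdet, hlev⟩ := exists_optimal_design U hU
  obtain ⟨B, hB⟩ := exists_eq_transpose_mul_self (weightedGram_posSemidef U hp0)
  have hBdet : IsUnit B.det := by
    rw [isUnit_iff_ne_zero]
    rintro h
    rw [hB, det_mul, h, mul_zero] at hdet
    exact hdet.false
  refine ⟨U * B⁻¹, B * V, ?_, fun i => ?_, fun j => ?_⟩
  · rw [Matrix.mul_assoc, nonsing_inv_mul_cancel_left _ _ hBdet, ← hT]
  · have h := hlev i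
    rw [Fintype.card_fin, hB, Matrix.mul_inv_rev, ← mulVec_mulVec, dotProduct_mulVec,
      ← transpose_nonsing_inv, mulVec_transpose] at h
    refine le_trans (le_of_eq ?_) h
    simp only [dotProduct, sq]
    rfl
  · have h := dotProduct_weightedGram U p (V.col j)
    rw [hB, ← mulVec_mulVec, dotProduct_mulVec, vecMul_transpose] at h
    have e : ∑ s, (B * V) s j ^ 2 = ∑ i, p i * T i j ^ 2 := by
      calc _ = B *ᵥ V.col j ⬝ᵥ B *ᵥ V.col j := by
            simp only [dotProduct, sq]; rfl
        _ = _ := by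
            rw [h]; conv_rhs => rw [hT]
            rfl
    rw [e]
    calc ∑ i, p i * T i j ^ 2 ≤ ∑ i, p i * τ ^ 2 := by
          refine Finset.sum_le_sum fun i _ => mul_le_mul_of_nonneg_left ?_ (hp0 i)
          exact sq_le_sq' (neg_le_of_abs_le (hτ i j)) (le_of_abs_le (hτ i j))
      _ = (∑ i, p i) * τ ^ 2 := by rw [Finset.sum_mul]
      _ ≤ τ ^ 2 := by nlinarith [sq_nonneg τ]

end Design

section SpecNorm

variable {m l : Type*} [Fintype m] [Fintype l] [DecidableEq l]

lemma specNorm_nonneg (M : Matrix m l ℝ) : 0 ≤ specNorm M := norm_nonneg _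

lemma specNorm_add_le (M N : Matrix m l ℝ) : specNorm (M + N) ≤ specNorm M + specNorm N := by
  simp only [specNorm, map_add]
  exact norm_add_le _ _

lemma sum_mulVec_sq_le (M : Matrix m l ℝ) (y : l → ℝ) :
    ∑ i, (M *ᵥ y) i ^ 2 ≤ specNorm M ^ 2 * ∑ j, y j ^ 2 := by
  have h := (LinearMap.toContinuousLinearMap (Matrix.toEuclideanLin M)).le_opNorm
    (WithLp.toLp 2 y)
  have h2 := pow_le_pow_left₀ (norm_nonneg _) h 2
  rw [mul_pow, EuclideanSpace.real_norm_sq_eq, EuclideanSpace.real_norm_sq_eq] at h2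
  exact h2

lemma specNorm_le_of_sum_mulVec_sq_le (M : Matrix m l ℝ) {C : ℝ} (hC : 0 ≤ C)
    (h : ∀ y : l → ℝ, ∑ i, (M *ᵥ y) i ^ 2 ≤ C ^ 2 * ∑ j, y j ^ 2) : specNorm M ≤ C := by
  refine ContinuousLinearMap.opNorm_le_bound _ hC fun y => ?_
  refine (sq_le_sq₀ (norm_nonneg _) (by positivity)).mp ?_
  rw [mul_pow, EuclideanSpace.real_norm_sq_eq, EuclideanSpace.real_norm_sq_eq]
  exact h y.ofLp

/-- Schur multiplier bound for a bounded matrix of low rank. -/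
lemma specNorm_hadamard_le [DecidableEq m] (A T : Matrix m l ℝ) {r : ℕ} (hr : T.rank ≤ r) {τ : ℝ}
    (hτ0 : 0 ≤ τ) (hτ : ∀ i j, |T i j| ≤ τ) :
    specNorm (A ⊙ T) ≤ Real.sqrt r * τ * specNorm A := by
  obtain ⟨U, V, hT, hU, hV⟩ := exists_balanced_factorization T hτ
  have hr' : (T.rank : ℝ) ≤ r := by exact_mod_cast hr
  refine specNorm_le_of_sum_mulVec_sq_le _
    (mul_nonneg (mul_nonneg (Real.sqrt_nonneg _) hτ0) (specNorm_nonneg A)) fun y => ?_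
  rw [mul_pow, mul_pow, Real.sq_sqrt r.cast_nonneg]
  have expand : ∀ i, ((A ⊙ T) *ᵥ y) i = ∑ s, U i s * (A *ᵥ fun j => V s j * y j) i := by
    intro i
    simp only [mulVec, dotProduct, Matrix.hadamard_apply, Finset.mul_sum]
    rw [Finset.sum_comm]
    refine Finset.sum_congr rfl fun j _ => ?_
    have hij : T i j = ∑ s, U i s * V s j := by
      conv_lhs => rw [hT]
      rfl
    rw [hij, Finset.mul_sum, Finset.sum_mul]
    exact Finset.sum_congr rfl fun s _ => by ring
  calc ∑ i, ((A ⊙ T) *ᵥ y) i ^ 2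
      ≤ ∑ i, (r : ℝ) * ∑ s, (A *ᵥ fun j => V s j * y j) i ^ 2 := by
        refine Finset.sum_le_sum fun i _ => ?_
        rw [expand]
        refine (Finset.sum_mul_sq_le_sq_mul_sq _ _ _).trans ?_
        exact mul_le_mul_of_nonneg_right ((hU i).trans hr')
          (Finset.sum_nonneg fun _ _ => sq_nonneg _)
    _ = r * ∑ s, ∑ i, (A *ᵥ fun j => V s j * y j) i ^ 2 := by
        rw [← Finset.mul_sum, Finset.sum_comm]
    _ ≤ r * ∑ s, specNorm A ^ 2 * ∑ j, (V s j * y j) ^ 2 := by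
        gcongr with s
        exact sum_mulVec_sq_le A _
    _ = r * specNorm A ^ 2 * ∑ j, (∑ s, V s j ^ 2) * y j ^ 2 := by
        rw [← Finset.mul_sum, Finset.sum_comm, mul_assoc]
        simp only [mul_pow, Finset.sum_mul]
    _ ≤ r * specNorm A ^ 2 * ∑ j, τ ^ 2 * y j ^ 2 := by
        gcongr with j
        exact hV j
    _ = r * τ ^ 2 * specNorm A ^ 2 * ∑ j, y j ^ 2 := by
        rw [← Finset.mul_sum]; ring

end SpecNorm

lemma infNorm_nonneg (X : Tensor d) : 0 ≤ infNorm X := Real.iSup_nonneg fun _ => abs_nonneg _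

lemma abs_le_infNorm (X : Tensor d) (i : Index d) : |X i| ≤ infNorm X :=
  le_ciSup (f := fun i => |X i|) (Set.finite_range _).bddAbove i

theorem matricization_deviation_bound
    {n : ℕ} {d : Fin n → ℕ} (w : ∀ j, Fin (d j) → ℝ) (W : Tensor d)
    (hW : W = outer w) (hWpos : ∀ i, 0 < W i)
    (Ω : Finset (Index d)) (k : Fin n) (rk : ℕ)
    (T : Tensor d) (hT : (matricize k T).rank ≤ rk) (Z : Tensor d) :
    specNorm (matricize k
        (fun i => epow W (-(1/2)) i * (indic Ω i * (T i + Z i)) - epow W (1/2) i * T i)) ≤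
      Real.sqrt (rk : ℝ) * infNorm T *
          specNorm (matricize k (fun i => epow W (-(1/2)) i * indic Ω i - epow W (1/2) i))
        + specNorm (matricize k (hadamard (epow W (-(1/2))) (fun i => indic Ω i * Z i))) := by
  have split : matricize k
      (fun i => epow W (-(1/2)) i * (indic Ω i * (T i + Z i)) - epow W (1/2) i * T i) =
      matricize k (fun i => epow W (-(1/2)) i * indic Ω i - epow W (1/2) i) ⊙ matricize k T +
        matricize k (hadamard (epow W (-(1/2))) (fun i => indic Ω i * Z i)) := by
    ext a b
    simp only [matricize, hadamard, Matrix.hadamard_apply, Matrix.add_apply]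
    ring
  rw [split]
  refine (specNorm_add_le _ _).trans (add_le_add_left ?_ _)
  exact specNorm_hadamard_le _ _ hT (infNorm_nonneg T) fun _ _ => abs_le_infNorm T _

end WTC
end

section
/- Let W = w₁⊗⋯⊗wₙ ∈ ℝ^{d₁×⋯×dₙ} be a CP rank-one tensor whose every entry W_{i₁⋯iₙ} lies in [1/√(d₁⋯dₙ), 1], and let Ω ∼ W be a random subset of [d₁]×⋯×[dₙ] (each tuple included independently with probability W_{i₁⋯iₙ}). For ℓ = 1,…,n set μ_ℓ² = max{ max_{i_ℓ} Σ_{others} 1_{(i₁,…,iₙ)∈Ω}/W_{i₁⋯iₙ}, max_{others} Σ_{i_ℓ} 1_{(i₁,…,iₙ)∈Ω}/W_{i₁⋯iₙ} }. Then with probability at least 1 − Σ_{ℓ=1}^n 2/(d_ℓ + ∏_{j≠ℓ}d_j) over the choice of Ω, for every ℓ = 1,…,n: ‖(W^{(1/2)} − W^{(−1/2)}∘1_Ω)_{(ℓ)}‖₂ ≤ 2√(d_ℓ + ∏_{k≠ℓ}d_k)·log(d_ℓ + ∏_{k≠ℓ}d_k) and μ_ℓ ≤ 2√((d_ℓ +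 ∏_{k≠ℓ}d_k)·log(d_ℓ + ∏_{k≠ℓ}d_k)). -/
open MeasureTheory ProbabilityTheory Matrix
open scoped BigOperators ENNReal

namespace WTC

variable {n : ℕ}

variable {d : Fin n → ℕ}

section LieProduct

variable {A : Type*} [NormedRing A] [NormOneClass A]

theorem norm_pow_sub_pow_le {x y : A} {M : ℝ} (hM : 1 ≤ M) (hx : ‖x‖ ≤ M) (hy : ‖y‖ ≤ M)
    (n : ℕ) : ‖x ^ n - y ^ n‖ ≤ n * M ^ n * ‖x - y‖ := by
  have hM0 : 0 ≤ M := zero_le_one.trans hM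
  induction n with
  | zero => simp
  | succ n ih =>
    have h1 : x ^ (n + 1) - y ^ (n + 1) = x ^ n * (x - y) + (x ^ n - y ^ n) * y := by
      rw [pow_succ, pow_succ]; noncomm_ring
    have h2 : ‖x ^ n * (x - y)‖ ≤ M ^ (n + 1) * ‖x - y‖ := by
      refine (norm_mul_le _ _).trans ?_
      gcongr
      calc ‖x ^ n‖ ≤ ‖x‖ ^ n := norm_pow_le _ _
        _ ≤ M ^ n := by gcongr
        _ ≤ M ^ (n + 1) := pow_le_pow_right₀ hM n.le_succ
    have h3 : ‖(x ^ n - y ^ n) * y‖ ≤ n * M ^ n * ‖x - y‖ * M :=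
      (norm_mul_le _ _).trans (by gcongr)
    calc _ ≤ ‖x ^ n * (x - y)‖ + ‖(x ^ n - y ^ n) * y‖ := h1 ▸ norm_add_le _ _
      _ ≤ M ^ (n + 1) * ‖x - y‖ + n * M ^ n * ‖x - y‖ * M := add_le_add h2 h3
      _ = _ := by push_cast; ring

variable [NormedAlgebra ℝ A]

/-- Two curves through `1` with the same velocity there have asymptotically equal powers
`f (1 / n) ^ n`. -/
theorem tendsto_pow_sub_pow_of_hasDerivAt {f g : ℝ → A} {c : A} (hf : HasDerivAt f c 0)
    (hg : HasDerivAt g c 0) (hf0 : f 0 = 1) (hg0 : g 0 = 1) :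
    Filter.Tendsto (fun n : ℕ => f (n : ℝ)⁻¹ ^ n - g (n : ℝ)⁻¹ ^ n) Filter.atTop (nhds 0) := by
  have hlim : Filter.Tendsto (fun n : ℕ => (n : ℝ)⁻¹) Filter.atTop (nhds 0) :=
    tendsto_inv_atTop_nhds_zero_nat
  have bound : ∀ {h : ℝ → A}, HasDerivAt h c 0 → h 0 = 1 →
      ∀ᶠ t in nhds (0 : ℝ), ‖h t‖ ≤ 1 + (‖c‖ + 1) * |t| := by
    intro h hh h0
    have := (hasDerivAt_iff_isLittleO.mp hh).bound one_pos
    filter_upwards [this] with t ht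
    simp only [sub_zero, h0, one_mul, Real.norm_eq_abs] at ht
    have : h t = (h t - 1 - t • c) + (1 + t • c) := by abel
    calc ‖h t‖ ≤ ‖h t - 1 - t • c‖ + ‖1 + t • c‖ := by
          conv_lhs => rw [this]
          exact norm_add_le _ _
      _ ≤ |t| + (1 + |t| * ‖c‖) := by
          refine add_le_add ht ((norm_add_le _ _).trans ?_)
          rw [norm_one, norm_smul, Real.norm_eq_abs]
      _ = _ := by ring
  have hdiff : (fun t => f t - g t) =o[nhds (0 : ℝ)] fun t => t := by
    have := hasDerivAt_iff_isLittleO.mp (hf.sub hg)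
    simpa [hf0, hg0] using this
  set K := ‖c‖ + 1 with hK
  have hK0 : 0 ≤ K := by positivity
  rw [Metric.tendsto_nhds]
  intro ε hε
  have hδ : 0 < ε / (2 * Real.exp K) := by positivity
  filter_upwards [hlim.eventually (bound hf hf0), hlim.eventually (bound hg hg0),
    hlim.eventually (hdiff.bound hδ), Filter.eventually_gt_atTop 0] with n h1 h2 h3 hn
  have hn' : (0 : ℝ) < n := by exact_mod_cast hn
  have habs : |(n : ℝ)⁻¹| = (n : ℝ)⁻¹ := abs_of_pos (by positivity)
  rw [habs] at h1 h2
  rw [Real.norm_eq_abs, habs] at h3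
  have hM : (1 + K * (n : ℝ)⁻¹) ^ n ≤ Real.exp K := by
    calc (1 + K * (n : ℝ)⁻¹) ^ n ≤ Real.exp (K * (n : ℝ)⁻¹) ^ n := by
          gcongr
          linarith [Real.add_one_le_exp (K * (n : ℝ)⁻¹)]
      _ = Real.exp K := by rw [← Real.exp_nat_mul]; congr 1; field_simp
  rw [dist_zero_right]
  calc _ ≤ n * (1 + K * (n : ℝ)⁻¹) ^ n * ‖f (n : ℝ)⁻¹ - g (n : ℝ)⁻¹‖ :=
        norm_pow_sub_pow_le (le_add_of_nonneg_right (by positivity)) h1 h2 n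
    _ ≤ n * Real.exp K * (ε / (2 * Real.exp K) * (n : ℝ)⁻¹) := by gcongr
    _ = ε / 2 := by field_simp
    _ < ε := by linarith

variable [CompleteSpace A]

/-- The Lie product formula. -/
theorem tendsto_exp_mul_exp_pow (a b : A) :
    Filter.Tendsto (fun n : ℕ => (NormedSpace.exp ((n : ℝ)⁻¹ • a) *
      NormedSpace.exp ((n : ℝ)⁻¹ • b)) ^ n) Filter.atTop (nhds (NormedSpace.exp (a + b))) := by
  have key : ∀ c : A, HasDerivAt (fun t : ℝ => NormedSpace.exp (t • c)) c 0 := fun c => by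
    simpa using hasDerivAt_exp_smul_const (𝕂 := ℝ) c 0
  have hf : HasDerivAt (fun t : ℝ => NormedSpace.exp (t • a) * NormedSpace.exp (t • b))
      (a + b) 0 := by
    simpa using (key a).fun_mul (key b)
  have := tendsto_pow_sub_pow_of_hasDerivAt hf (key (a + b)) (by simp) (by simp)
  rw [← zero_add (NormedSpace.exp (a + b))]
  refine (this.add_const _).congr' ?_
  filter_upwards [Filter.eventually_gt_atTop 0] with n hn
  have hn' : (n : ℝ) ≠ 0 := by exact_mod_cast hn.ne'
  let _ : NormedAlgebra ℚ A := NormedAlgebra.restrictScalars ℚ ℝ A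
  rw [← NormedSpace.exp_nsmul n ((n : ℝ)⁻¹ • (a + b)), ← Nat.cast_smul_eq_nsmul ℝ, smul_smul,
    mul_inv_cancel₀ hn', one_smul, sub_add_cancel]

end LieProduct

section GoldenThompson

variable {ι : Type*} [Fintype ι]

theorem trace_mul_transpose_self_nonneg (X : Matrix ι ι ℝ) : 0 ≤ (X * Xᵀ).trace := by
  simp only [trace, diag_apply, mul_apply, transpose_apply]
  exact Finset.sum_nonneg fun i _ => Finset.sum_nonneg fun j _ => mul_self_nonneg _

theorem trace_mul_self_le (X : Matrix ι ι ℝ) : (X * X).trace ≤ (X * Xᵀ).trace := by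
  have h := trace_mul_transpose_self_nonneg (X - Xᵀ)
  have h1 : (Xᵀ * Xᵀ).trace = (X * X).trace := by rw [← transpose_mul, trace_transpose]
  rw [transpose_sub, transpose_transpose, sub_mul, mul_sub, mul_sub, trace_sub, trace_sub,
    trace_sub, h1, trace_mul_comm Xᵀ X] at h
  linarith

theorem two_mul_trace_mul_le {P Q : Matrix ι ι ℝ} (hP : P.IsSymm) (hQ : Q.IsSymm) :
    2 * (P * Q).trace ≤ (P * P).trace + (Q * Q).trace := by
  have h := trace_mul_transpose_self_nonneg (P - Q)
  rw [transpose_sub, hP.eq, hQ.eq, sub_mul, mul_sub, mul_sub, trace_sub, trace_sub,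
    trace_sub, trace_mul_comm Q P] at h
  linarith

variable [DecidableEq ι]

theorem trace_mul_pow_comm (A B : Matrix ι ι ℝ) (n : ℕ) :
    ((A * B) ^ n).trace = ((B * A) ^ n).trace := by
  cases n with
  | zero => simp
  | succ n =>
    have h : ∀ m : ℕ, (A * B) ^ m * A = A * (B * A) ^ m := by
      intro m
      induction m with
      | zero => simp
      | succ m ih => rw [pow_succ', mul_assoc, ih, pow_succ']; simp only [mul_assoc]
    rw [pow_succ, ← mul_assoc, h, mul_assoc, trace_mul_comm, mul_assoc, ← pow_succ]

theorem trace_pow_two_pow_le (k : ℕ) :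
    (∀ P Q : Matrix ι ι ℝ, P.IsSymm → Q.IsSymm →
      ((P * Q) ^ 2 ^ k).trace ≤ (P ^ 2 ^ k * Q ^ 2 ^ k).trace) ∧
    ∀ X : Matrix ι ι ℝ, (X ^ 2 ^ (k + 1)).trace ≤ ((X * Xᵀ) ^ 2 ^ k).trace := by
  induction k with
  | zero => exact ⟨by simp, fun X => by simpa [sq] using trace_mul_self_le X⟩
  | succ k ih =>
    obtain ⟨ih₁, ih₂⟩ := ih
    have two : ∀ (Y : Matrix ι ι ℝ) (m : ℕ), Y ^ 2 ^ (m + 1) = (Y * Y) ^ 2 ^ m := fun Y m => by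
      rw [pow_succ', pow_mul, sq]
    refine ⟨fun P Q hP hQ => ?_, fun X => ?_⟩
    · calc _ ≤ ((P * Q * (P * Q)ᵀ) ^ 2 ^ k).trace := ih₂ _
        _ = ((P * P * (Q * Q)) ^ 2 ^ k).trace := by
            rw [transpose_mul, hP.eq, hQ.eq, ← mul_assoc, trace_mul_pow_comm]
            simp only [mul_assoc]
        _ ≤ _ := ih₁ _ _ (by simpa [sq] using hP.pow 2) (by simpa [sq] using hQ.pow 2)
        _ = _ := by rw [two P k, two Q k]
    · have h1 : (X * Xᵀ).IsSymm := isSymm_mul_transpose_self X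
      have h2 : (Xᵀ * X).IsSymm := isSymm_transpose_mul_self X
      have h3 := two_mul_trace_mul_le (h1.pow (2 ^ k)) (h2.pow (2 ^ k))
      have h4 : ∀ Y : Matrix ι ι ℝ, Y ^ 2 ^ k * Y ^ 2 ^ k = Y ^ 2 ^ (k + 1) := fun Y => by
        rw [← pow_add, pow_succ, mul_two]
      rw [h4, h4, trace_mul_pow_comm Xᵀ X] at h3
      calc _ = ((X * X) ^ 2 ^ (k + 1)).trace := by rw [two X (k + 1)]
        _ ≤ ((X * X * (X * X)ᵀ) ^ 2 ^ k).trace := ih₂ _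
        _ = ((X * Xᵀ * (Xᵀ * X)) ^ 2 ^ k).trace := by
            rw [transpose_mul, mul_assoc X X, trace_mul_pow_comm X]
            simp only [mul_assoc]
        _ ≤ ((X * Xᵀ) ^ 2 ^ k * (Xᵀ * X) ^ 2 ^ k).trace := ih₁ _ _ h1 h2
        _ ≤ _ := by linarith

/-- The Golden–Thompson inequality for real symmetric matrices. -/
theorem trace_exp_add_le {A B : Matrix ι ι ℝ} (hA : A.IsSymm) (hB : B.IsSymm) :
    (NormedSpace.exp (A + B)).trace ≤ (NormedSpace.exp A * NormedSpace.exp B).trace := by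
  rcases isEmpty_or_nonempty ι with h | h
  · simp [trace]
  let _ : NormedRing (Matrix ι ι ℝ) := Matrix.linftyOpNormedRing
  let _ : NormedAlgebra ℝ (Matrix ι ι ℝ) := Matrix.linftyOpNormedAlgebra
  have _ : NormOneClass (Matrix ι ι ℝ) := Matrix.linfty_opNormOneClass
  have lim := (tendsto_exp_mul_exp_pow A B).comp
    (tendsto_pow_atTop_atTop_of_one_lt (one_lt_two (α := ℕ)))
  have lim' := ((continuous_id.matrix_trace).tendsto _).comp lim
  refine le_of_tendsto' lim' fun k => ?_
  have hexp : ∀ C : Matrix ι ι ℝ,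
      NormedSpace.exp (((2 ^ k : ℕ) : ℝ)⁻¹ • C) ^ 2 ^ k = NormedSpace.exp C := fun C => by
    rw [← Matrix.exp_nsmul, ← Nat.cast_smul_eq_nsmul ℝ, smul_smul, mul_inv_cancel₀, one_smul]
    positivity
  have := (trace_pow_two_pow_le k).1 _ _ (hA.smul (((2 ^ k : ℕ) : ℝ)⁻¹)).exp
    (hB.smul (((2 ^ k : ℕ) : ℝ)⁻¹)).exp
  rw [hexp, hexp] at this
  exact this

end GoldenThompson

section MatrixExp

variable {ι : Type*} [Fintype ι] [DecidableEq ι]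

theorem trace_exp_mul_nonneg {H N : Matrix ι ι ℝ} (hH : H.IsSymm) (hN : N.PosSemidef) :
    0 ≤ (NormedSpace.exp H * N).trace := by
  have h : NormedSpace.exp H =
      (NormedSpace.exp ((2 : ℝ)⁻¹ • H))ᴴ * NormedSpace.exp ((2 : ℝ)⁻¹ • H) := by
    rw [conjTranspose_eq_transpose_of_trivial, (hH.smul (2 : ℝ)⁻¹).exp.eq,
      ← Matrix.exp_add_of_commute _ _ (Commute.refl _), ← add_smul]
    norm_num
  rw [h, mul_assoc, trace_mul_comm]
  exact (hN.mul_mul_conjTranspose_same _).trace_nonneg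

theorem exp_smul_of_mul_self_eq {Q : Matrix ι ι ℝ} (hQ : Q * Q = Q) (a : ℝ) :
    NormedSpace.exp (a • Q) = 1 + (Real.exp a - 1) • Q := by
  let _ : NormedRing (Matrix ι ι ℝ) := Matrix.linftyOpNormedRing
  let _ : NormedAlgebra ℝ (Matrix ι ι ℝ) := Matrix.linftyOpNormedAlgebra
  have h1 := NormedSpace.exp_series_hasSum_exp' (𝕂 := ℝ) (a • Q)
  have h2 : HasSum (fun n : ℕ => (n.factorial : ℝ)⁻¹ • a ^ n) (Real.exp a) := by
    rw [Real.exp_eq_exp_ℝ]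
    exact NormedSpace.exp_series_hasSum_exp' (𝕂 := ℝ) a
  have h3 := (h2.smul_const Q).add (hasSum_ite_eq 0 (1 - Q))
  have h4 : ∀ n : ℕ, (n.factorial : ℝ)⁻¹ • (a • Q) ^ n =
      ((n.factorial : ℝ)⁻¹ • a ^ n) • Q + if n = 0 then 1 - Q else 0 := by
    intro n
    cases n with
    | zero => simp
    | succ n =>
      have hpow : Q ^ (n + 1) = Q := by
        induction n with
        | zero => simp
        | succ n ih => rw [pow_succ, ih, hQ]
      rw [smul_pow, hpow, smul_smul, if_neg n.succ_ne_zero, add_zero, smul_eq_mul]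
  rw [funext h4] at h1
  refine (h1.unique h3).trans ?_
  rw [sub_smul, one_smul]
  abel

theorem exp_smul_sub_smul_sq {A : Matrix ι ι ℝ} (hA : A * A * A = A) (x c : ℝ) :
    NormedSpace.exp (x • A - c • (A * A)) = 1 +
      (Real.exp (x - c) - 1) • ((2 : ℝ)⁻¹ • (A * A + A)) +
      (Real.exp (-x - c) - 1) • ((2 : ℝ)⁻¹ • (A * A - A)) := by
  have hA' : A * A * (A * A) = A * A := by rw [← mul_assoc, hA]
  have hA'' : A * (A * A) = A := by rw [← mul_assoc, hA]
  have hp : ((2 : ℝ)⁻¹ • (A * A + A)) * ((2 : ℝ)⁻¹ • (A * A + A)) = (2 : ℝ)⁻¹ • (A * A + A) := by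
    simp only [smul_mul_smul_comm, mul_add, add_mul, hA, hA', hA'']
    module
  have hm : ((2 : ℝ)⁻¹ • (A * A - A)) * ((2 : ℝ)⁻¹ • (A * A - A)) = (2 : ℝ)⁻¹ • (A * A - A) := by
    simp only [smul_mul_smul_comm, mul_sub, sub_mul, hA, hA', hA'']
    module
  have hpm : ((2 : ℝ)⁻¹ • (A * A + A)) * ((2 : ℝ)⁻¹ • (A * A - A)) = 0 := by
    simp only [smul_mul_smul_comm, mul_sub, add_mul, hA, hA', hA'']
    module
  have hmp : ((2 : ℝ)⁻¹ • (A * A - A)) * ((2 : ℝ)⁻¹ • (A * A + A)) = 0 := by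
    simp only [smul_mul_smul_comm, mul_add, sub_mul, hA, hA', hA'']
    module
  have hsplit : x • A - c • (A * A) = (x - c) • ((2 : ℝ)⁻¹ • (A * A + A)) +
      (-x - c) • ((2 : ℝ)⁻¹ • (A * A - A)) := by module
  have hcomm : Commute ((x - c) • ((2 : ℝ)⁻¹ • (A * A + A)))
      ((-x - c) • ((2 : ℝ)⁻¹ • (A * A - A))) :=
    ((show Commute _ _ from hpm.trans hmp.symm).smul_left _).smul_right _
  rw [hsplit, Matrix.exp_add_of_commute _ _ hcomm, exp_smul_of_mul_self_eq hp,
    exp_smul_of_mul_self_eq hm, mul_add, add_mul, add_mul, smul_mul_smul_comm, hpm]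
  simp

theorem exp_le_trace_exp {H : Matrix ι ι ℝ} (hH : H.IsSymm) {s : ℝ} {v : ι → ℝ}
    (hv : s * (v ⬝ᵥ v) < v ⬝ᵥ H *ᵥ v) : Real.exp s ≤ (NormedSpace.exp H).trace := by
  have hH' : H.IsHermitian := by rwa [IsHermitian, conjTranspose_eq_transpose_of_trivial]
  set U : Matrix ι ι ℝ := hH'.eigenvectorUnitary.1
  set D := hH'.eigenvalues
  have hUU : Uᴴ * U = 1 := (Unitary.mem_iff.mp hH'.eigenvectorUnitary.2).1
  have hUU' : U * Uᴴ = 1 := (Unitary.mem_iff.mp hH'.eigenvectorUnitary.2).2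
  have hspec : H = U * diagonal D * Uᴴ := by
    conv_lhs => rw [hH'.spectral_theorem, Unitary.conjStarAlgAut_apply]
    rfl
  have hinv : U⁻¹ = Uᴴ := inv_eq_right_inv hUU'
  have htr : (NormedSpace.exp H).trace = ∑ i, Real.exp (D i) := by
    rw [hspec, ← hinv, Matrix.exp_conj _ _ (IsUnit.of_mul_eq_one _ hUU'), hinv, trace_mul_comm,
      ← mul_assoc, hUU, one_mul, Matrix.exp_diagonal, trace_diagonal]
    simp [Real.exp_eq_exp_ℝ, Pi.coe_exp]
  rw [htr]
  by_contra! hlt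
  have hle : ∀ i, D i ≤ s := fun i => Real.exp_le_exp.mp <|
    (Finset.single_le_sum (f := fun i => Real.exp (D i)) (fun j _ => (Real.exp_pos _).le)
      (Finset.mem_univ i)).trans hlt.le
  have hpsd : (U * diagonal (fun i => s - D i) * Uᴴ).PosSemidef :=
    (PosSemidef.diagonal fun i => sub_nonneg.mpr (hle i)).mul_mul_conjTranspose_same U
  have heq : U * diagonal (fun i => s - D i) * Uᴴ = s • 1 - H := by
    rw [← diagonal_sub, mul_sub, sub_mul, ← hspec]
    congr 1
    rw [show diagonal (fun _ : ι => s) = s • (1 : Matrix ι ι ℝ) from (smul_one_eq_diagonal s).symm,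
      mul_smul_comm, smul_mul_assoc, mul_one, hUU']
  have := hpsd.dotProduct_mulVec_nonneg v
  rw [heq, sub_mulVec, smul_mulVec, one_mulVec, dotProduct_sub, dotProduct_smul] at this
  simp only [star_trivial, smul_eq_mul] at this
  linarith

end MatrixExp

section Patterns

variable {I : Type*} [Fintype I] [DecidableEq I]

/-- The mass that a Bernoulli variable of parameter `p` gives to `b`. -/
def bernWeight (p : ℝ) (b : Bool) : ℝ := if b then p else 1 - p

theorem bernWeight_nonneg {p : ℝ} (hp : p ∈ Set.Icc 0 1) (b : Bool) : 0 ≤ bernWeight p b := by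
  cases b <;> simp [bernWeight, hp.1, hp.2]

theorem sum_bernWeight_mul (p : ℝ) (f : Bool → ℝ) :
    ∑ b, bernWeight p b * f b = p * f true + (1 - p) * f false := by
  simp [bernWeight]

/-- Expectation of `f` when each `ω i` is an independent Bernoulli variable of parameter `p i`. -/
def patExp (p : I → ℝ) (f : (I → Bool) → ℝ) : ℝ := ∑ ω, (∏ i, bernWeight (p i) (ω i)) * f ω

theorem patExp_mono {p : I → ℝ} (hp : ∀ i, p i ∈ Set.Icc 0 1) {f g : (I → Bool) → ℝ}
    (h : ∀ ω, f ω ≤ g ω) : patExp p f ≤ patExp p g :=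
  Finset.sum_le_sum fun ω _ => mul_le_mul_of_nonneg_left (h ω) <|
    Finset.prod_nonneg fun i _ => bernWeight_nonneg (hp i) _

theorem patExp_const_mul (p : I → ℝ) (a : ℝ) (f : (I → Bool) → ℝ) :
    patExp p (fun ω => a * f ω) = a * patExp p f := by
  simp only [patExp, Finset.mul_sum]
  exact Finset.sum_congr rfl fun ω _ => by ring

theorem patExp_prod (p : I → ℝ) (g : I → Bool → ℝ) :
    patExp p (fun ω => ∏ i, g i (ω i)) = ∏ i, ∑ b, bernWeight (p i) b * g i b := by
  simp only [patExp, ← Finset.prod_mul_distrib]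
  rw [Finset.prod_univ_sum, Fintype.piFinset_univ]

theorem patExp_const (p : I → ℝ) (a : ℝ) : patExp p (fun _ => a) = a := by
  have h : patExp p (fun _ => 1) = 1 := by
    simpa [bernWeight] using patExp_prod p fun _ _ => 1
  simpa only [mul_one, h] using patExp_const_mul p a fun _ => 1

/-- Resampling one coordinate does not change the expectation. -/
theorem patExp_resample (p : I → ℝ) (k : I) (f : (I → Bool) → ℝ) :
    patExp p f = patExp p fun ω => ∑ b, bernWeight (p k) b * f (Function.update ω k b) := by
  have hinv : ∀ x : (I → Bool) × Bool,
      (Function.update (Function.update x.1 k x.2) k (x.1 k),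
        Function.update x.1 k x.2 k) = x := fun x => by simp
  let e : (I → Bool) × Bool ≃ (I → Bool) × Bool :=
    ⟨fun x => (Function.update x.1 k x.2, x.1 k), fun x => (Function.update x.1 k x.2, x.1 k),
      hinv, hinv⟩
  have hprod : ∀ ω : I → Bool, (∏ i, bernWeight (p i) (ω i)) =
      bernWeight (p k) (ω k) * ∏ i ∈ Finset.univ.erase k, bernWeight (p i) (ω i) := fun ω =>
    (Finset.mul_prod_erase _ _ (Finset.mem_univ k)).symm
  have hone : ∑ b, bernWeight (p k) b = 1 := by simp [bernWeight]
  calc patExp p f = ∑ ω : I → Bool, ∑ b,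
        (∏ i, bernWeight (p i) (ω i)) * (bernWeight (p k) b * f ω) := by
        refine Finset.sum_congr rfl fun ω _ => ?_
        rw [← Finset.mul_sum, ← Finset.sum_mul, hone, one_mul]
    _ = ∑ x : (I → Bool) × Bool,
        (∏ i, bernWeight (p i) (x.1 i)) * (bernWeight (p k) x.2 * f x.1) := by
        rw [Fintype.sum_prod_type]
    _ = ∑ x : (I → Bool) × Bool, (∏ i, bernWeight (p i) (x.1 i)) *
        (bernWeight (p k) x.2 * f (Function.update x.1 k x.2)) := by
        rw [← e.sum_comp]
        refine Finset.sum_congr rfl fun x _ => ?_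
        have herase : ∏ i ∈ Finset.univ.erase k, bernWeight (p i) (Function.update x.1 k x.2 i) =
            ∏ i ∈ Finset.univ.erase k, bernWeight (p i) (x.1 i) :=
          Finset.prod_congr rfl fun i hi => by rw [Function.update_of_ne (Finset.ne_of_mem_erase hi)]
        simp only [e, Equiv.coe_fn_mk]
        rw [hprod, hprod x.1, herase, Function.update_self]
        ring
    _ = _ := by
        rw [Fintype.sum_prod_type]
        exact Finset.sum_congr rfl fun ω _ => by rw [Finset.mul_sum]

/-- Markov's inequality. -/
theorem patExp_indicator_le {p : I → ℝ} (hp : ∀ i, p i ∈ Set.Icc 0 1) {f : (I → Bool) → ℝ}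
    (hf : ∀ ω, 0 ≤ f ω) {s : Set (I → Bool)} {a : ℝ} (ha : 0 < a) (hs : ∀ ω ∈ s, a ≤ f ω) :
    patExp p (s.indicator 1) ≤ a⁻¹ * patExp p f := by
  rw [← patExp_const_mul]
  refine patExp_mono hp fun ω => ?_
  by_cases h : ω ∈ s
  · rw [Set.indicator_of_mem h, Pi.one_apply, inv_mul_eq_div]
    exact (one_le_div ha).mpr (hs ω h)
  · rw [Set.indicator_of_notMem h]
    exact mul_nonneg (by positivity) (hf ω)

theorem patExp_indicator_iUnion_le {p : I → ℝ} (hp : ∀ i, p i ∈ Set.Icc 0 1) {J : Type*}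
    [Fintype J] (s : J → Set (I → Bool)) : patExp p ((⋃ j, s j).indicator 1) ≤
      ∑ j, patExp p ((s j).indicator 1) := by
  simp only [patExp]
  rw [Finset.sum_comm]
  simp only [← Finset.mul_sum]
  refine patExp_mono hp fun ω => ?_
  have hnn : ∀ j ∈ Finset.univ, (0 : ℝ) ≤ (s j).indicator 1 ω := fun j _ =>
    Set.indicator_nonneg (fun _ _ => zero_le_one) _
  by_cases h : ω ∈ ⋃ j, s j
  · obtain ⟨j, hj⟩ := Set.mem_iUnion.mp h
    rw [Set.indicator_of_mem h]
    have := Finset.single_le_sum hnn (Finset.mem_univ j)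
    rwa [Set.indicator_of_mem hj] at this
  · rw [Set.indicator_of_notMem h]
    exact Finset.sum_nonneg hnn

theorem pi_bern_apply {p : I → ℝ} (hp : ∀ i, p i ∈ Set.Icc 0 1) (s : Set (I → Bool)) :
    Measure.pi (fun i => bern (p i)) s = ENNReal.ofReal (patExp p (s.indicator 1)) := by
  classical
  have hfin : ∀ i, IsFiniteMeasure (bern (p i)) := fun i =>
    ⟨by simp [bern, ENNReal.add_lt_top]⟩
  have hsing : ∀ q : ℝ, ∀ b, bern q {b} = ENNReal.ofReal (bernWeight q b) := fun q b => by
    cases b <;> simp [bern, bernWeight]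
  have hs : s = ↑(Finset.univ.filter (· ∈ s)) := by ext; simp
  have hnn : ∀ ω ∈ Finset.univ, (0 : ℝ) ≤ (∏ i, bernWeight (p i) (ω i)) * s.indicator 1 ω :=
    fun ω _ => mul_nonneg (Finset.prod_nonneg fun i _ => bernWeight_nonneg (hp i) _)
      (Set.indicator_nonneg (fun _ _ => zero_le_one) _)
  conv_lhs => rw [hs]
  rw [← sum_measure_singleton]
  simp only [Measure.pi_singleton, hsing]
  rw [patExp, Finset.sum_filter, ENNReal.ofReal_sum_of_nonneg hnn]
  refine Finset.sum_congr rfl fun ω _ => ?_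
  by_cases h : ω ∈ s
  · simp only [h, if_true, Set.indicator_of_mem, Pi.one_apply, mul_one]
    rw [ENNReal.ofReal_prod_of_nonneg fun i _ => bernWeight_nonneg (hp i) _]
  · simp [h]

end Patterns

section MatrixConcentration

variable {I ι : Type*} [Fintype I] [DecidableEq I] [Fintype ι] [DecidableEq ι]

/-- The trace moment generating function of a sum of independent symmetric matrices, each having
exponential mean at most `1`. -/
theorem patExp_trace_exp_add_sum_le {p : I → ℝ} (hp : ∀ i, p i ∈ Set.Icc 0 1)
    {Y : I → Bool → Matrix ι ι ℝ} (hY : ∀ i b, (Y i b).IsSymm)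
    (hmean : ∀ i, (1 - ∑ b, bernWeight (p i) b • NormedSpace.exp (Y i b)).PosSemidef)
    {H : Matrix ι ι ℝ} (hH : H.IsSymm) (s : Finset I) :
    patExp p (fun ω => (NormedSpace.exp (H + ∑ i ∈ s, Y i (ω i))).trace) ≤
      (NormedSpace.exp H).trace := by
  induction s using Finset.induction_on with
  | empty => simp [patExp_const]
  | insert k s hk ih =>
    rw [patExp_resample p k]
    refine (patExp_mono hp fun ω => ?_).trans ih
    set G := H + ∑ i ∈ s, Y i (ω i) with hG
    have hGs : G.IsSymm := by
      rw [IsSymm, hG, transpose_add, hH.eq, transpose_sum]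
      exact congrArg _ (Finset.sum_congr rfl fun i _ => hY i _)
    have hupd : ∀ b, H + ∑ i ∈ insert k s, Y i (Function.update ω k b i) = G + Y k b := by
      intro b
      have : ∑ i ∈ s, Y i (Function.update ω k b i) = ∑ i ∈ s, Y i (ω i) :=
        Finset.sum_congr rfl fun i hi => by
          rw [Function.update_of_ne (ne_of_mem_of_not_mem hi hk)]
      rw [Finset.sum_insert hk, this, Function.update_self, hG]
      abel
    simp only [hupd]
    have h := trace_exp_mul_nonneg hGs (hmean k)
    rw [mul_sub, mul_one, trace_sub, Finset.mul_sum, trace_sum] at h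
    simp only [mul_smul_comm, trace_smul, smul_eq_mul] at h
    refine le_trans (Finset.sum_le_sum fun b _ => ?_) (sub_nonneg.mp h)
    exact mul_le_mul_of_nonneg_left (trace_exp_add_le hGs (hY k b)) (bernWeight_nonneg (hp k) b)

/-- Bernstein-type bound for `∑ ξᵢ Aᵢ` with fixed symmetric partial isometries `Aᵢ` and independent
scalar coefficients `ξᵢ`. -/
theorem patExp_trace_exp_le {p : I → ℝ} (hp : ∀ i, p i ∈ Set.Icc 0 1)
    {A : I → Matrix ι ι ℝ} (hA : ∀ i, (A i).IsSymm) (hA3 : ∀ i, A i * A i * A i = A i)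
    {ξ : I → Bool → ℝ} {c : ℝ}
    (hpos : ∀ i, ∑ b, bernWeight (p i) b * Real.exp (ξ i b) ≤ Real.exp c)
    (hneg : ∀ i, ∑ b, bernWeight (p i) b * Real.exp (-ξ i b) ≤ Real.exp c)
    {V : ℝ} {r : ι → ℝ} (hr : ∀ j, r j ≤ V) (hvar : c • ∑ i, A i * A i = diagonal r) :
    patExp p (fun ω => (NormedSpace.exp (∑ i, ξ i (ω i) • A i - V • 1)).trace) ≤
      Fintype.card ι := by
  have hA2 : ∀ i, (A i * A i).IsSymm := fun i => by simpa [sq] using (hA i).pow 2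
  have hA4 : ∀ i, A i * A i * (A i * A i) = A i * A i := fun i => by rw [← mul_assoc, hA3]
  have hA4' : ∀ i, A i * (A i * A i) = A i := fun i => by rw [← mul_assoc, hA3]
  have hscal : ∀ i, ∀ η : Bool → ℝ, ∑ b, bernWeight (p i) b * Real.exp (η b) ≤ Real.exp c →
      0 ≤ 1 - ∑ b, bernWeight (p i) b * Real.exp (η b - c) := by
    intro i η h
    simp only [Real.exp_sub, ← mul_div_assoc, ← Finset.sum_div]
    exact sub_nonneg.mpr ((div_le_one (Real.exp_pos c)).mpr h)
  have hplus : ∀ i, ((2 : ℝ)⁻¹ • (A i * A i + A i)).PosSemidef := fun i => by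
    have := posSemidef_self_mul_conjTranspose ((2 : ℝ)⁻¹ • (A i * A i + A i))
    rw [conjTranspose_eq_transpose_of_trivial, transpose_smul, transpose_add, (hA2 i).eq,
      (hA i).eq] at this
    convert this using 1
    simp only [smul_mul_smul_comm, mul_add, add_mul, hA3, hA4, hA4']
    module
  have hminus : ∀ i, ((2 : ℝ)⁻¹ • (A i * A i - A i)).PosSemidef := fun i => by
    have := posSemidef_self_mul_conjTranspose ((2 : ℝ)⁻¹ • (A i * A i - A i))
    rw [conjTranspose_eq_transpose_of_trivial, transpose_smul, transpose_sub, (hA2 i).eq,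
      (hA i).eq] at this
    convert this using 1
    simp only [smul_mul_smul_comm, mul_sub, sub_mul, hA3, hA4, hA4']
    module
  have key := patExp_trace_exp_add_sum_le hp (Y := fun i b => ξ i b • A i - c • (A i * A i))
    (fun i b => ((hA i).smul _).sub ((hA2 i).smul _)) (fun i => ?_)
    (H := diagonal fun j => r j - V) (isSymm_diagonal _) Finset.univ
  · have heq : ∀ ω : I → Bool, diagonal (fun j => r j - V) +
        ∑ i, (ξ i (ω i) • A i - c • (A i * A i)) = ∑ i, ξ i (ω i) • A i - V • 1 := fun ω => by
      rw [Finset.sum_sub_distrib, ← Finset.smul_sum, hvar, ← diagonal_sub, smul_one_eq_diagonal]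
      abel
    simp only [heq] at key
    refine key.trans ?_
    rw [Matrix.exp_diagonal, trace_diagonal]
    refine (Finset.sum_le_card_nsmul _ _ 1 fun j _ => ?_).trans (by simp)
    rw [Pi.coe_exp, ← Real.exp_eq_exp_ℝ]
    exact Real.exp_le_one_iff.mpr (sub_nonpos.mpr (hr j))
  · have h1 := (hplus i).smul (hscal i _ (hpos i))
    have h2 := (hminus i).smul (hscal i _ (hneg i))
    convert h1.add h2 using 1
    simp only [exp_smul_sub_smul_sq (hA3 i), Fintype.sum_bool]
    have : bernWeight (p i) false = 1 - bernWeight (p i) true := by simp [bernWeight]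
    rw [this]
    module

end MatrixConcentration

section ScalarBounds

theorem exp_le_quadratic {u : ℝ} (hu : |u| ≤ 1) : Real.exp u ≤ 1 + u + 13 / 18 * u ^ 2 := by
  have h := Real.exp_bound hu (n := 3) (by norm_num)
  have h3 : |u| ^ 3 ≤ u ^ 2 := by
    rw [← sq_abs]
    exact pow_le_pow_of_le_one (abs_nonneg u) hu (by norm_num)
  norm_num [Finset.sum_range_succ, Nat.factorial] at h
  have := (abs_le.mp h).2
  nlinarith

theorem bernoulli_mgf_le (p : ℝ) (u : ℝ) :
    p * Real.exp u + (1 - p) ≤ Real.exp (p * (Real.exp u - 1)) := by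
  linarith [Real.add_one_le_exp (p * (Real.exp u - 1))]

theorem bernoulli_centered_mgf_le {p u : ℝ} (hp : 0 ≤ p) (hu : |u| ≤ 1) :
    p * Real.exp (u - p * u) + (1 - p) * Real.exp (-(p * u)) ≤
      Real.exp (13 / 18 * (p * u ^ 2)) := by
  have h1 : p * Real.exp (u - p * u) + (1 - p) * Real.exp (-(p * u)) =
      (p * Real.exp u + (1 - p)) * Real.exp (-(p * u)) := by
    rw [sub_eq_add_neg u, Real.exp_add]; ring
  rw [h1]
  calc _ ≤ Real.exp (p * (Real.exp u - 1)) * Real.exp (-(p * u)) := by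
        gcongr
        exact bernoulli_mgf_le p u
    _ = Real.exp (p * (Real.exp u - 1 - u)) := by rw [← Real.exp_add]; ring_nf
    _ ≤ _ := by
        apply Real.exp_le_exp.mpr
        nlinarith [mul_le_mul_of_nonneg_left (exp_le_quadratic hu) hp]

theorem log_three_ge : (109 / 100 : ℝ) ≤ Real.log 3 := by
  rw [Real.le_log_iff_exp_le (by norm_num)]
  have h := exp_le_quadratic (u := 9 / 100) (by norm_num [abs_le])
  have h1 : Real.exp (109 / 100) = Real.exp 1 * Real.exp (9 / 100) := by
    rw [← Real.exp_add]; norm_num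
  rw [h1]
  nlinarith [Real.exp_one_lt_d9, Real.exp_pos 1, Real.exp_pos (9 / 100)]

theorem spectral_tail_le {D : ℝ} (hD : 3 ≤ D) :
    (Real.exp (2 * Real.sqrt 2 * Real.log D - 13 / 9))⁻¹ * D ≤ 19 / 10 / D := by
  have hD0 : 0 < D := by linarith
  have hlog : 109 / 100 ≤ Real.log D := log_three_ge.trans (Real.log_le_log (by norm_num) hD)
  have hsqrt : 7 / 5 ≤ Real.sqrt 2 := Real.le_sqrt_of_sq_le (by norm_num)
  have hexp : (Real.exp (2 * Real.sqrt 2 * Real.log D - 13 / 9))⁻¹ * D * D =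
      Real.exp (13 / 9 - 2 * Real.sqrt 2 * Real.log D + 2 * Real.log D) := by
    rw [← Real.exp_neg, neg_sub, Real.exp_add, two_mul (Real.log D), Real.exp_add,
      Real.exp_log hD0]
    ring
  rw [le_div_iff₀ hD0, hexp]
  calc _ ≤ Real.exp (573 / 1000) := Real.exp_le_exp.mpr (by nlinarith)
    _ ≤ _ := (exp_le_quadratic (by norm_num [abs_le])).trans (by norm_num)

theorem marginal_tail_le {D : ℝ} (hD : 3 ≤ D) :
    D * ((Real.exp (8 * Real.log D))⁻¹ * Real.exp (31 / 9)) ≤ 1 / 10 / D := by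
  have hD0 : 0 < D := by linarith
  have hlog : 109 / 100 ≤ Real.log D := log_three_ge.trans (Real.log_le_log (by norm_num) hD)
  have hexp : D * ((Real.exp (8 * Real.log D))⁻¹ * Real.exp (31 / 9)) * D =
      Real.exp (31 / 9 - 8 * Real.log D + 2 * Real.log D) := by
    rw [← Real.exp_neg, Real.exp_add, two_mul (Real.log D), Real.exp_add, Real.exp_log hD0,
      sub_eq_add_neg, Real.exp_add]
    ring
  rw [le_div_iff₀ hD0, hexp]
  have h3 : Real.exp 3 = Real.exp 1 ^ 3 := by rw [← Real.exp_nat_mul]; norm_num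
  have h10 : 10 ≤ Real.exp 3 := by
    rw [h3]
    calc (10 : ℝ) ≤ 2.7 ^ 3 := by norm_num
      _ ≤ _ := by gcongr; linarith [Real.exp_one_gt_d9]
  calc _ ≤ Real.exp (-3) := Real.exp_le_exp.mpr (by linarith)
    _ ≤ _ := by rw [Real.exp_neg, one_div]; gcongr

end ScalarBounds

section RandomMatrix

variable {m κ : Type*} [DecidableEq κ]

section

variable [Fintype m] [Fintype κ]

theorem exists_dilation_of_lt_specNorm {M : Matrix m κ ℝ} {t : ℝ} (ht : 0 < t)
    (h : t < specNorm M) :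
    ∃ v : m ⊕ κ → ℝ, t * (v ⬝ᵥ v) < v ⬝ᵥ fromBlocks 0 M Mᵀ 0 *ᵥ v := by
  by_contra! H
  refine h.not_ge (ContinuousLinearMap.opNorm_le_bound _ ht.le fun y => ?_)
  set x : m → ℝ := M *ᵥ y.ofLp with hx
  have hv := H (Sum.elim (t⁻¹ • x) y.ofLp)
  have h1 : ‖LinearMap.toContinuousLinearMap (toEuclideanLin M) y‖ ^ 2 = x ⬝ᵥ x := by
    rw [EuclideanSpace.real_norm_sq_eq]
    simp [dotProduct, hx, sq]
  have h2 : ‖y‖ ^ 2 = y.ofLp ⬝ᵥ y.ofLp := by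
    rw [EuclideanSpace.real_norm_sq_eq]
    simp [dotProduct, sq]
  have h3 : y.ofLp ⬝ᵥ Mᵀ *ᵥ x = x ⬝ᵥ x := by
    rw [mulVec_transpose, ← dotProduct_comm, ← dotProduct_mulVec]
  rw [fromBlocks_mulVec] at hv
  simp only [sumElim_dotProduct_sumElim, zero_mulVec, zero_add, add_zero, Function.comp_def,
    Sum.elim_inl, Sum.elim_inr, smul_dotProduct, dotProduct_smul, smul_eq_mul, ← h2] at hv
  rw [show (fun i => (t⁻¹ • x) i) = t⁻¹ • x from rfl, mulVec_smul, dotProduct_smul, h3, ← hx,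
    ← h1, smul_eq_mul] at hv
  refine le_of_sq_le_sq ?_ (by positivity)
  have e1 : t * (t⁻¹ * (t⁻¹ * ‖LinearMap.toContinuousLinearMap (toEuclideanLin M) y‖ ^ 2) +
      ‖y‖ ^ 2) = t⁻¹ * ‖LinearMap.toContinuousLinearMap (toEuclideanLin M) y‖ ^ 2 +
      t * ‖y‖ ^ 2 := by field_simp
  rw [e1] at hv
  have h4 : t⁻¹ * ‖LinearMap.toContinuousLinearMap (toEuclideanLin M) y‖ ^ 2 ≤ t * ‖y‖ ^ 2 := by
    linarith
  rw [inv_mul_le_iff₀ ht] at h4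
  rw [mul_pow]
  linarith

end

variable [DecidableEq m]

/-- The Hermitian dilation of a matrix unit. -/
def dilatedUnit (i : m) (j : κ) : Matrix (m ⊕ κ) (m ⊕ κ) ℝ :=
  fromBlocks 0 (single i j 1) (single j i 1) 0

theorem dilatedUnit_isSymm (i : m) (j : κ) : (dilatedUnit i j).IsSymm := by
  simp [IsSymm, dilatedUnit, fromBlocks_transpose]

variable [Fintype m] [Fintype κ]

theorem dilatedUnit_mul_self (i : m) (j : κ) :
    dilatedUnit i j * dilatedUnit i j = fromBlocks (single i i 1) 0 0 (single j j 1) := by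
  simp [dilatedUnit, fromBlocks_multiply]

theorem dilatedUnit_mul_mul (i : m) (j : κ) :
    dilatedUnit i j * dilatedUnit i j * dilatedUnit i j = dilatedUnit i j := by
  rw [dilatedUnit_mul_self]
  simp [dilatedUnit, fromBlocks_multiply]

theorem sum_smul_dilatedUnit (M : Matrix m κ ℝ) :
    ∑ x : m × κ, M x.1 x.2 • dilatedUnit x.1 x.2 = fromBlocks 0 M Mᵀ 0 := by
  ext (a | a) (b | b) <;>
    simp [Matrix.sum_apply, dilatedUnit, Fintype.sum_prod_type, single_apply, ite_and]

theorem sum_dilatedUnit_mul_self :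
    ∑ x : m × κ, dilatedUnit x.1 x.2 * dilatedUnit x.1 x.2 =
      diagonal (Sum.elim (fun _ => (Fintype.card κ : ℝ)) fun _ => (Fintype.card m : ℝ)) := by
  ext (a | a) (b | b) <;>
    simp [Matrix.sum_apply, dilatedUnit_mul_self, Fintype.sum_prod_type, single_apply, ite_and,
      diagonal_apply] <;> split_ifs <;> simp

end RandomMatrix

section RandomPattern

variable {I m : Type*} [Fintype I] [DecidableEq I] [Fintype m] {p : I → ℝ} {D : ℝ}

theorem patExp_lt_sum_inv_le (hD : 3 ≤ D) (hcard : (Fintype.card m : ℝ) ≤ D)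
    (hlow : ∀ i, 2 / D ≤ p i) (hp : ∀ i, p i ≤ 1) {g : m → I} (hg : g.Injective) :
    patExp p ({ω | 4 * (D * Real.log D) <
      ∑ j, if ω (g j) then 1 / p (g j) else 0}.indicator 1) ≤
      (Real.exp (8 * Real.log D))⁻¹ * Real.exp (31 / 9) := by
  have hD0 : 0 < D := by linarith
  have hp0 : ∀ i, 0 < p i := fun i => (by positivity : 0 < 2 / D).trans_le (hlow i)
  have hpI : ∀ i, p i ∈ Set.Icc 0 1 := fun i => ⟨(hp0 i).le, hp i⟩
  have hexp : ∀ ω : I → Bool, Real.exp (2 / D * ∑ j, if ω (g j) then 1 / p (g j) else 0) =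
      ∏ i, if i ∈ Finset.univ.image g then Real.exp (if ω i then 2 / D / p i else 0) else 1 := by
    intro ω
    rw [Finset.prod_ite_mem, Finset.univ_inter, Finset.prod_image hg.injOn, Finset.mul_sum,
      Real.exp_sum]
    refine Finset.prod_congr rfl fun j _ => ?_
    rw [mul_ite, mul_zero, mul_one_div]
  refine (patExp_indicator_le hpI
    (f := fun ω => Real.exp (2 / D * ∑ j, if ω (g j) then 1 / p (g j) else 0))
    (fun ω => (Real.exp_pos _).le) (Real.exp_pos _) fun ω hω => ?_).trans
    (mul_le_mul_of_nonneg_left ?_ (by positivity))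
  · refine Real.exp_le_exp.mpr ?_
    calc 8 * Real.log D = 2 / D * (4 * (D * Real.log D)) := by field_simp; ring
      _ ≤ _ := mul_le_mul_of_nonneg_left (le_of_lt hω) (by positivity)
  · simp only [hexp]
    rw [patExp_prod p fun i b =>
      if i ∈ Finset.univ.image g then Real.exp (if b then 2 / D / p i else 0) else 1]
    have hfac : ∀ i, ∑ b, bernWeight (p i) b *
        (if i ∈ Finset.univ.image g then Real.exp (if b then 2 / D / p i else 0) else 1) ≤
        if i ∈ Finset.univ.image g then Real.exp (31 / 9 / D) else 1 := by
      intro i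
      rw [sum_bernWeight_mul]
      by_cases h : i ∈ Finset.univ.image g
      · have hu0 : 0 ≤ 2 / D / p i := div_nonneg (by positivity) (hp0 i).le
        have hu1 : 2 / D / p i ≤ 1 := (div_le_one (hp0 i)).mpr (hlow i)
        have hpu : p i * (2 / D / p i) = 2 / D := mul_div_cancel₀ _ (hp0 i).ne'
        have hq := exp_le_quadratic (abs_le.mpr ⟨by linarith, hu1⟩)
        simp only [if_pos h, if_true, Bool.false_eq_true, if_false, Real.exp_zero, mul_one]
        refine (bernoulli_mgf_le _ _).trans (Real.exp_le_exp.mpr ?_)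
        calc p i * (Real.exp (2 / D / p i) - 1) ≤ p i * (31 / 18 * (2 / D / p i)) :=
              mul_le_mul_of_nonneg_left (by nlinarith) (hp0 i).le
          _ = 31 / 18 * (2 / D) := by rw [mul_left_comm, hpu]
          _ = 31 / 9 / D := by ring
      · simp only [if_neg h]
        linarith
    refine (Finset.prod_le_prod (fun i _ => Finset.sum_nonneg fun b _ =>
      mul_nonneg (bernWeight_nonneg (hpI i) b) (by split_ifs <;> positivity))
      fun i _ => hfac i).trans ?_
    rw [Finset.prod_ite_mem, Finset.univ_inter, Finset.prod_const,
      Finset.card_image_of_injective _ hg, Finset.card_univ, ← Real.exp_nat_mul]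
    refine Real.exp_le_exp.mpr ?_
    calc (Fintype.card m : ℝ) * (31 / 9 / D) ≤ D * (31 / 9 / D) := by gcongr
      _ = 31 / 9 := by field_simp

variable {κ : Type*} [Fintype κ] [DecidableEq m] [DecidableEq κ]

theorem patExp_lt_specNorm_le (hD : 3 ≤ D)
    (hcard : (Fintype.card m : ℝ) + Fintype.card κ = D) (hlow : ∀ i, 2 / D ≤ p i)
    (hp : ∀ i, p i ≤ 1) (e : m × κ ≃ I) :
    patExp p ({ω | 2 * Real.sqrt D * Real.log D < specNorm (of fun (a : m) (b : κ) =>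
      Real.sqrt (p (e (a, b))) -
        (Real.sqrt (p (e (a, b))))⁻¹ * if ω (e (a, b)) then 1 else 0)}.indicator 1) ≤
      19 / 10 / D := by
  have hD0 : 0 < D := by linarith
  have hp0 : ∀ i, 0 < p i := fun i => (by positivity : 0 < 2 / D).trans_le (hlow i)
  have hpI : ∀ i, p i ∈ Set.Icc 0 1 := fun i => ⟨(hp0 i).le, hp i⟩
  have hlog : 0 < Real.log D := Real.log_pos (by linarith)
  set θ := Real.sqrt (2 / D) with hθ
  have hθ0 : 0 < θ := Real.sqrt_pos.mpr (by positivity)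
  have hθsq : θ ^ 2 = 2 / D := Real.sq_sqrt (by positivity)
  have hθD : θ * Real.sqrt D = Real.sqrt 2 := by
    rw [hθ, ← Real.sqrt_mul (by positivity), div_mul_cancel₀ _ hD0.ne']
  set M : (I → Bool) → Matrix m κ ℝ := fun ω => of fun a b => Real.sqrt (p (e (a, b))) -
    (Real.sqrt (p (e (a, b))))⁻¹ * if ω (e (a, b)) then 1 else 0 with hM
  set A : I → Matrix (m ⊕ κ) (m ⊕ κ) ℝ := fun i => dilatedUnit (e.symm i).1 (e.symm i).2 with hA
  set ξ : I → Bool → ℝ := fun i b =>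
    θ * (Real.sqrt (p i) - (Real.sqrt (p i))⁻¹ * if b then 1 else 0) with hξ
  have hsum : ∀ ω : I → Bool,
      ∑ i, ξ i (ω i) • A i = θ • fromBlocks 0 (M ω) (M ω)ᵀ 0 := fun ω => by
    rw [← sum_smul_dilatedUnit, Finset.smul_sum, ← e.sum_comp]
    refine Finset.sum_congr rfl fun x _ => ?_
    rw [smul_smul]
    simp [hξ, hA, hM]
  have hsym : ∀ ω : I → Bool, (∑ i, ξ i (ω i) • A i - (13 / 9 : ℝ) • 1).IsSymm := fun ω => by
    rw [hsum]
    refine IsSymm.sub (IsSymm.smul ?_ _) (isSymm_one.smul _)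
    simp [IsSymm, fromBlocks_transpose]
  have hu : ∀ i, θ / Real.sqrt (p i) ≤ 1 := fun i =>
    (div_le_one (Real.sqrt_pos.mpr (hp0 i))).mpr (Real.sqrt_le_sqrt (hlow i))
  have hu0 : ∀ i, 0 ≤ θ / Real.sqrt (p i) := fun i => by positivity
  have hpu : ∀ i, p i * (θ / Real.sqrt (p i)) = θ * Real.sqrt (p i) := fun i => by
    rw [mul_div_assoc', mul_comm, mul_div_assoc, Real.div_sqrt]
  have hpu2 : ∀ i, p i * (θ / Real.sqrt (p i)) ^ 2 = 2 / D := fun i => by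
    rw [div_pow, Real.sq_sqrt (hp0 i).le, mul_div_cancel₀ _ (hp0 i).ne', hθsq]
  have hmgf := patExp_trace_exp_le hpI (A := A) (ξ := ξ) (c := 13 / 18 * (2 / D))
    (fun i => dilatedUnit_isSymm _ _) (fun i => dilatedUnit_mul_mul _ _) (fun i => ?_)
    (fun i => ?_) (V := 13 / 9) (r := fun j => 13 / 18 * (2 / D) *
      Sum.elim (fun _ => (Fintype.card κ : ℝ)) (fun _ => (Fintype.card m : ℝ)) j) (fun j => ?_) ?_
  · refine (patExp_indicator_le hpI (fun ω => ?_)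
      (Real.exp_pos (2 * Real.sqrt 2 * Real.log D - 13 / 9)) fun ω hω => ?_).trans
      ((mul_le_mul_of_nonneg_left hmgf (by positivity)).trans ?_)
    · simpa using trace_exp_mul_nonneg (hsym ω) PosSemidef.one
    · obtain ⟨v, hv⟩ := exists_dilation_of_lt_specNorm (by positivity) hω
      refine exp_le_trace_exp (hsym ω) (v := v) ?_
      rw [hsum, sub_mulVec, smul_mulVec, smul_mulVec, one_mulVec, dotProduct_sub, dotProduct_smul,
        dotProduct_smul, smul_eq_mul, smul_eq_mul, sub_mul]
      have := mul_lt_mul_of_pos_left hv hθ0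
      rw [← hθD]
      linarith
    · rw [Fintype.card_sum, Nat.cast_add, hcard]
      exact spectral_tail_le hD
  · have := bernoulli_centered_mgf_le (hp0 i).le (u := -(θ / Real.sqrt (p i)))
      (by rw [abs_neg, abs_of_nonneg (hu0 i)]; exact hu i)
    rw [neg_sq, hpu2, mul_neg, hpu] at this
    rw [sum_bernWeight_mul]
    convert this using 4 <;> simp [hξ]; ring
  · have := bernoulli_centered_mgf_le (hp0 i).le (u := θ / Real.sqrt (p i))
      (by rw [abs_of_nonneg (hu0 i)]; exact hu i)
    rw [hpu2, hpu] at this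
    rw [sum_bernWeight_mul]
    convert this using 4 <;> simp [hξ]; ring
  · have hm : (0 : ℝ) ≤ Fintype.card m := Nat.cast_nonneg _
    have hκ : (0 : ℝ) ≤ Fintype.card κ := Nat.cast_nonneg _
    have hle : Sum.elim (fun _ => (Fintype.card κ : ℝ)) (fun _ => (Fintype.card m : ℝ)) j ≤ D := by
      cases j <;> simp <;> linarith
    calc _ ≤ 13 / 18 * (2 / D) * D := mul_le_mul_of_nonneg_left hle (by positivity)
      _ = 13 / 9 := by field_simp; norm_num
  · have : ∑ i, A i * A i = ∑ x : m × κ, dilatedUnit x.1 x.2 * dilatedUnit x.1 x.2 := by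
      rw [← e.sum_comp]
      simp [hA]
    rw [this, sum_dilatedUnit_mul_self, ← diagonal_smul]
    rfl

end RandomPattern

section Matricization

/-- A row index and a column index of the mode-`k` matricization determine a full index. -/
def embedEquiv (d : Fin n → ℕ) (k : Fin n) : Fin (d k) × RestIdx d k ≃ Index d where
  toFun x := embed k x.1 x.2
  invFun i := (i k, fun j => i j)
  left_inv x := by
    refine Prod.ext (by simp [embed]) (funext fun j => ?_)
    simp [embed, j.2]
  right_inv i := by
    funext j
    by_cases h : j = k
    · subst h; simp [embed]
    · simp [embed, h]

theorem card_restIdx (d : Fin n → ℕ) (k : Fin n) :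
    Fintype.card (RestIdx d k) = ∏ j ∈ Finset.univ.erase k, d j := by
  rw [Fintype.card_pi]
  simp only [Fintype.card_fin]
  rw [← Finset.prod_subtype (Finset.univ.erase k) (by simp) d]

theorem Dk_eq_card (d : Fin n → ℕ) (k : Fin n) :
    Dk d k = (Fintype.card (Fin (d k)) : ℝ) + Fintype.card (RestIdx d k) := by
  rw [card_restIdx, Fintype.card_fin, Dk, Nat.cast_prod]

theorem Dk_eq_natCast (d : Fin n → ℕ) (k : Fin n) :
    ∃ D : ℕ, Dk d k = D := ⟨_, by rw [Dk_eq_card]; exact (Nat.cast_add _ _).symm⟩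

theorem two_le_Dk [Nonempty (Index d)] (k : Fin n) : 2 ≤ Dk d k := by
  obtain ⟨i⟩ := ‹Nonempty (Index d)›
  have h1 : 0 < Fintype.card (Fin (d k)) := Fintype.card_pos_iff.mpr ⟨i k⟩
  have h2 : 0 < Fintype.card (RestIdx d k) := Fintype.card_pos_iff.mpr ⟨fun j => i j⟩
  rw [Dk_eq_card]
  exact_mod_cast Nat.add_le_add h1 h2

theorem two_div_Dk_le [Nonempty (Index d)] (k : Fin n) :
    2 / Dk d k ≤ 1 / Real.sqrt (∏ j, (d j : ℝ)) := by
  obtain ⟨i⟩ := ‹Nonempty (Index d)›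
  have hpos : ∀ j, (0 : ℝ) < d j := fun j => Nat.cast_pos.mpr (i j).pos
  have hprod : 0 < ∏ j, (d j : ℝ) := Finset.prod_pos fun j _ => hpos j
  have hP : 0 < ∏ j ∈ Finset.univ.erase k, (d j : ℝ) := Finset.prod_pos fun j _ => hpos j
  have hsqrt : Real.sqrt (∏ j, (d j : ℝ)) ≤ Dk d k / 2 := by
    refine Real.sqrt_le_iff.mpr ⟨by unfold Dk; linarith [hpos k], ?_⟩
    rw [← Finset.mul_prod_erase _ _ (Finset.mem_univ k), Dk]
    nlinarith [sq_nonneg ((d k : ℝ) - ∏ j ∈ Finset.univ.erase k, (d j : ℝ))]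
  rw [← one_div_div]
  exact one_div_le_one_div_of_le (Real.sqrt_pos.mpr hprod) hsqrt

/-- The patterns for which both mode-`l` bounds hold. -/
def goodPatterns (W : Tensor d) (l : Fin n) : Set (Index d → Bool) :=
  {ω | specNorm (matricize l (fun i => epow W (1/2) i - epow W (-(1/2)) i * bindic ω i))
      ≤ 2 * Real.sqrt (Dk d l) * Real.log (Dk d l) ∧
    Real.sqrt (max
        (⨆ il : Fin (d l), ∑ rest : RestIdx d l,
          (if ω (embed l il rest) then 1 / W (embed l il rest) else 0))
        (⨆ rest : RestIdx d l, ∑ il : Fin (d l),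
          (if ω (embed l il rest) then 1 / W (embed l il rest) else 0)))
      ≤ 2 * Real.sqrt (Dk d l * Real.log (Dk d l))}

theorem log_Dk_nonneg (d : Fin n → ℕ) (l : Fin n) : 0 ≤ Real.log (Dk d l) := by
  obtain ⟨D, hD⟩ := Dk_eq_natCast d l
  exact hD ▸ Real.log_natCast_nonneg D

theorem Dk_nonneg (d : Fin n → ℕ) (l : Fin n) : 0 ≤ Dk d l := by
  obtain ⟨D, hD⟩ := Dk_eq_natCast d l
  exact hD ▸ D.cast_nonneg

theorem mem_goodPatterns {W : Tensor d} {l : Fin n} {ω : Index d → Bool}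
    (hspec : specNorm (matricize l (fun i => epow W (1/2) i - epow W (-(1/2)) i * bindic ω i))
      ≤ 2 * Real.sqrt (Dk d l) * Real.log (Dk d l))
    (hrow : ∀ il : Fin (d l), ∑ rest : RestIdx d l,
      (if ω (embed l il rest) then 1 / W (embed l il rest) else 0) ≤
        4 * (Dk d l * Real.log (Dk d l)))
    (hcol : ∀ rest : RestIdx d l, ∑ il : Fin (d l),
      (if ω (embed l il rest) then 1 / W (embed l il rest) else 0) ≤
        4 * (Dk d l * Real.log (Dk d l))) : ω ∈ goodPatterns W l := by
  refine ⟨hspec, ?_⟩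
  have h0 : 0 ≤ Dk d l * Real.log (Dk d l) := mul_nonneg (Dk_nonneg d l) (log_Dk_nonneg d l)
  have h4 : 2 * Real.sqrt (Dk d l * Real.log (Dk d l)) =
      Real.sqrt (4 * (Dk d l * Real.log (Dk d l))) := by
    rw [Real.sqrt_mul zero_le_four, show (4 : ℝ) = 2 ^ 2 by norm_num, Real.sqrt_sq zero_le_two]
  rw [h4]
  exact Real.sqrt_le_sqrt (max_le (Real.iSup_le hrow (by positivity))
    (Real.iSup_le hcol (by positivity)))

theorem mem_goodPatterns_of_isEmpty [IsEmpty (Index d)] (W : Tensor d) (l : Fin n)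
    (ω : Index d → Bool) : ω ∈ goodPatterns W l := by
  have hlog := log_Dk_nonneg d l
  have hD := Dk_nonneg d l
  refine mem_goodPatterns ?_ (fun il => ?_) fun rest => ?_
  · have : matricize l (fun i => epow W (1/2) i - epow W (-(1/2)) i * bindic ω i) = 0 := by
      ext a b
      exact isEmptyElim (embed l a b)
    rw [this, specNorm, map_zero, map_zero, norm_zero]
    positivity
  · rw [Finset.sum_eq_zero fun rest _ => isEmptyElim (embed l il rest)]
    positivity
  · rw [Finset.sum_eq_zero fun il _ => isEmptyElim (embed l il rest)]
    positivity

theorem matricize_weighted_eq {W : Tensor d} (hW : ∀ i, 0 < W i) (l : Fin n)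
    (ω : Index d → Bool) :
    matricize l (fun i => epow W (1/2) i - epow W (-(1/2)) i * bindic ω i) =
      of fun a b => Real.sqrt (W (embedEquiv d l (a, b))) -
        (Real.sqrt (W (embedEquiv d l (a, b))))⁻¹ *
          if ω (embedEquiv d l (a, b)) then 1 else 0 := by
  ext a b
  simp only [matricize, epow, bindic, of_apply, Real.rpow_neg (hW _).le, ← Real.sqrt_eq_rpow]
  rfl

theorem patExp_compl_goodPatterns_le [Nonempty (Index d)] {W : Tensor d}
    (hlow : ∀ i, 1 / Real.sqrt (∏ j, (d j : ℝ)) ≤ W i) (hup : ∀ i, W i ≤ 1) {l : Fin n}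
    (hD : 3 ≤ Dk d l) : patExp W ((goodPatterns W l)ᶜ.indicator 1) ≤ 2 / Dk d l := by
  have hD0 : 0 < Dk d l := by linarith
  have hlow' : ∀ i, 2 / Dk d l ≤ W i := fun i => (two_div_Dk_le l).trans (hlow i)
  have hpos : ∀ i, 0 < W i := fun i => (by positivity : 0 < 2 / Dk d l).trans_le (hlow' i)
  have hI : ∀ i, W i ∈ Set.Icc 0 1 := fun i => ⟨(hpos i).le, hup i⟩
  have hcard := (Dk_eq_card d l).symm
  have hr : (0 : ℝ) ≤ Fintype.card (Fin (d l)) := Nat.cast_nonneg _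
  have hc : (0 : ℝ) ≤ Fintype.card (RestIdx d l) := Nat.cast_nonneg _
  let s : Option (Fin (d l) ⊕ RestIdx d l) → Set (Index d → Bool)
    | none => {ω | 2 * Real.sqrt (Dk d l) * Real.log (Dk d l) <
        specNorm (of fun a b => Real.sqrt (W (embedEquiv d l (a, b))) -
          (Real.sqrt (W (embedEquiv d l (a, b))))⁻¹ *
            if ω (embedEquiv d l (a, b)) then 1 else 0)}
    | some (.inl a) => {ω | 4 * (Dk d l * Real.log (Dk d l)) <
        ∑ b, if ω (embedEquiv d l (a, b)) then 1 / W (embedEquiv d l (a, b)) else 0}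
    | some (.inr b) => {ω | 4 * (Dk d l * Real.log (Dk d l)) <
        ∑ a, if ω (embedEquiv d l (a, b)) then 1 / W (embedEquiv d l (a, b)) else 0}
  have hsub : (goodPatterns W l)ᶜ ⊆ ⋃ x, s x := by
    intro ω hω
    by_contra hs
    have hs' : ∀ x, ω ∉ s x := fun x hx => hs (Set.mem_iUnion.mpr ⟨x, hx⟩)
    refine hω (mem_goodPatterns ?_ (fun a => ?_) fun b => ?_)
    · rw [matricize_weighted_eq hpos]
      exact not_lt.mp (hs' none)
    · exact not_lt.mp (hs' (some (.inl a)))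
    · exact not_lt.mp (hs' (some (.inr b)))
  have hinj : (embedEquiv d l : Fin (d l) × RestIdx d l → Index d).Injective :=
    (embedEquiv d l).injective
  have hspec : patExp W ((s none).indicator 1) ≤ 19 / 10 / Dk d l :=
    patExp_lt_specNorm_le hD hcard hlow' hup (embedEquiv d l)
  have hmarg : ∀ x, patExp W ((s (some x)).indicator 1) ≤
      (Real.exp (8 * Real.log (Dk d l)))⁻¹ * Real.exp (31 / 9) := by
    rintro (a | b)
    · exact patExp_lt_sum_inv_le hD (by linarith) hlow' hup
        (hinj.comp (Prod.mk_right_injective a))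
    · exact patExp_lt_sum_inv_le hD (by linarith) hlow' hup
        (hinj.comp (Prod.mk_left_injective b))
  calc patExp W ((goodPatterns W l)ᶜ.indicator 1)
      ≤ patExp W ((⋃ x, s x).indicator 1) :=
        patExp_mono hI (Set.indicator_le_indicator_of_subset hsub fun _ => zero_le_one)
    _ ≤ ∑ x, patExp W ((s x).indicator 1) := patExp_indicator_iUnion_le hI s
    _ ≤ 19 / 10 / Dk d l + 1 / 10 / Dk d l := by
        rw [Fintype.sum_option]
        refine add_le_add hspec ((Finset.sum_le_card_nsmul _ _ _ fun x _ => hmarg x).trans ?_)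
        rw [Finset.card_univ, Fintype.card_sum, nsmul_eq_mul, Nat.cast_add, hcard]
        exact marginal_tail_le hD
    _ = 2 / Dk d l := by ring

end Matricization

theorem lambda_mu_bounds_random_pattern
    {n : ℕ} {d : Fin n → ℕ} (w : ∀ j, Fin (d j) → ℝ) (W : Tensor d)
    (hW : W = outer w)
    (hent : ∀ i, 1 / Real.sqrt (∏ j, (d j : ℝ)) ≤ W i ∧ W i ≤ 1) :
    ENNReal.ofReal (1 - ∑ l, 2 / Dk d l) ≤
      sampleMeasure W {ω : Index d → Bool | ∀ l : Fin n,
        specNorm (matricize l (fun i => epow W (1/2) i - epow W (-(1/2)) i * bindic ω i))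
            ≤ 2 * Real.sqrt (Dk d l) * Real.log (Dk d l) ∧
        Real.sqrt (max
            (⨆ il : Fin (d l), ∑ rest : RestIdx d l,
              (if ω (embed l il rest) then 1 / W (embed l il rest) else 0))
            (⨆ rest : RestIdx d l, ∑ il : Fin (d l),
              (if ω (embed l il rest) then 1 / W (embed l il rest) else 0)))
          ≤ 2 * Real.sqrt (Dk d l * Real.log (Dk d l))} := by
  have hI : ∀ i, W i ∈ Set.Icc 0 1 := fun i => ⟨le_trans (by positivity) (hent i).1, (hent i).2⟩
  change _ ≤ Measure.pi (fun i => bern (W i)) {ω | ∀ l, ω ∈ goodPatterns W l}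
  rw [pi_bern_apply hI]
  refine ENNReal.ofReal_le_ofReal ?_
  have hterm : ∀ l ∈ Finset.univ, 0 ≤ 2 / Dk d l := fun l _ => div_nonneg zero_le_two (Dk_nonneg d l)
  set G : Set (Index d → Bool) := {ω | ∀ l, ω ∈ goodPatterns W l} with hG
  have hG0 : 0 ≤ patExp W (G.indicator 1) :=
    (patExp_const W 0).ge.trans
      (patExp_mono hI (Set.indicator_nonneg fun _ _ => zero_le_one))
  cases isEmpty_or_nonempty (Index d) with
  | inl _ =>
    have huniv : G = Set.univ := Set.eq_univ_of_forall fun ω l => mem_goodPatterns_of_isEmpty W l ω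
    rw [huniv, Set.indicator_univ]
    exact (sub_le_self _ (Finset.sum_nonneg hterm)).trans (patExp_const W 1).ge
  | inr _ =>
    by_cases hD : ∀ l, 3 ≤ Dk d l
    · let s : Option (Fin n) → Set (Index d → Bool)
        | none => G
        | some l => (goodPatterns W l)ᶜ
      have hcover : ⋃ x, s x = Set.univ := by
        refine Set.eq_univ_of_forall fun ω => Set.mem_iUnion.mpr ?_
        by_cases h : ω ∈ G
        · exact ⟨none, h⟩
        · obtain ⟨l, hl⟩ := not_forall.mp h
          exact ⟨some l, hl⟩
      have hunion := patExp_indicator_iUnion_le hI s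
      rw [hcover, Set.indicator_univ, Fintype.sum_option] at hunion
      have hbad : ∑ l, patExp W ((s (some l)).indicator 1) ≤ ∑ l, 2 / Dk d l :=
        Finset.sum_le_sum fun l _ => patExp_compl_goodPatterns_le (fun i => (hent i).1)
          (fun i => (hent i).2) (hD l)
      have hone : patExp W 1 = 1 := patExp_const W 1
      have hgood : patExp W ((s none).indicator 1) = patExp W (G.indicator 1) := rfl
      linarith
    · obtain ⟨l, hl⟩ := not_forall.mp hD
      have h2 : Dk d l = 2 := by
        have h := two_le_Dk (d := d) l
        obtain ⟨D, hDl⟩ := Dk_eq_natCast d l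
        rw [hDl] at hl h ⊢
        have h3 : D < 3 := by exact_mod_cast not_le.mp hl
        have h4 : 2 ≤ D := by exact_mod_cast h
        exact_mod_cast (by omega : D = 2)
      have hle := Finset.single_le_sum hterm (Finset.mem_univ l)
      rw [h2, div_self two_ne_zero] at hle
      linarith

end WTC
end
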